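/- arXiv:2602.02062 — 4 statements merged into one kernel-verified Lean document; each statement's English description precedes it below -/
import Mathlib

section
/- Let $n \in \mathbb{N}$ and let $f \in C^n(\mathbb{R})$ be an even function. Define $F : \mathbb{R}^d \to \mathbb{C}$ by $F(\mu) = f(|\mu|)$. Then $F \in C^n(\mathbb{R}^d)$. -/
open Filter Topology Asymptotics
open scoped ContDiff Nat

/-- A `C^m` function whose derivatives up to order `m` vanish at `0` is `o(x ^ m)` there. -/
theorem isLittleO_pow_of_iteratedDeriv_eq_zero {m : ℕ} {h : ℝ → ℝ} (hh : ContDiff ℝ m h)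
    (h0 : ∀ k ≤ m, iteratedDeriv k h 0 = 0) : h =o[𝓝 0] fun x : ℝ => x ^ m := by
  have key := taylor_isLittleO_univ (x₀ := 0) hh
  have hz : ∀ x, taylorWithinEval h m Set.univ 0 x = 0 := by
    intro x
    rw [taylor_within_apply]
    refine Finset.sum_eq_zero fun k hk => ?_
    rw [iteratedDerivWithin_univ, h0 k (by simpa [Nat.lt_succ_iff] using hk), smul_zero]
  simpa [hz] using key

section Radial

variable {E F : Type} [NormedAddCommGroup E] [InnerProductSpace ℝ E]
  [NormedAddCommGroup F] [NormedSpace ℝ F]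

/-- A function homogeneous of degree `-k` and continuous off the origin is `O(‖x‖ ^ (-k))`. -/
theorem exists_bound_of_homogeneous [FiniteDimensional ℝ E] {A : E → F} {k : ℕ}
    (hA : ∀ x, x ≠ 0 → ContinuousAt A x)
    (hom : ∀ t : ℝ, 0 < t → ∀ x, t ^ k • A (t • x) = A x) :
    ∃ C, ∀ x, x ≠ 0 → ‖x‖ ^ k * ‖A x‖ ≤ C := by
  obtain ⟨C, hC⟩ := (isCompact_sphere (0 : E) 1).exists_bound_of_continuousOn (f := A)
    fun x hx => (hA x (by rintro rfl; simp at hx)).continuousWithinAt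
  refine ⟨C, fun x hx => ?_⟩
  have hx' : 0 < ‖x‖ := norm_pos_iff.2 hx
  have h1 := hom ‖x‖ hx' (‖x‖⁻¹ • x)
  rw [smul_smul, mul_inv_cancel₀ hx'.ne', one_smul] at h1
  have h2 := hC (‖x‖⁻¹ • x) (by simp [norm_smul, hx'.ne'])
  rwa [← h1, norm_smul, norm_pow, norm_norm] at h2

/-- The derivative of a homogeneous function of degree `-k` is homogeneous of degree `-(k + 1)`. -/
theorem fderiv_homogeneous {A : E → F} {k : ℕ}
    (hom : ∀ t : ℝ, 0 < t → ∀ x, t ^ k • A (t • x) = A x) (t : ℝ) (ht : 0 < t) (x : E) :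
    t ^ (k + 1) • fderiv ℝ A (t • x) = fderiv ℝ A x := by
  have h : (t ^ k • fun y => A (t • y)) = A := funext fun y => hom t ht y
  conv_rhs => rw [← h]
  rw [fderiv_const_smul_field, Pi.smul_apply, fderiv_comp_smul, smul_smul, pow_succ]

theorem fderiv_norm_homogeneous (t : ℝ) (ht : 0 < t) (x : E) :
    fderiv ℝ (norm : E → ℝ) (t • x) = fderiv ℝ norm x := by
  have h : (t⁻¹ • fun y : E => ‖t • y‖) = norm := by
    ext y
    simp [norm_smul, abs_of_pos ht, ht.ne']
  conv_rhs => rw [← h]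
  rw [fderiv_const_smul_field, Pi.smul_apply, fderiv_comp_smul (f := norm), smul_smul, inv_mul_cancel₀ ht.ne',
    one_smul]

/-- A radial function that is flat to order `m` at the origin, times a function which is smooth off
the origin and homogeneous of degree `-k`, is `o(‖x‖ ^ (m - k))`. -/
theorem isLittleO_radial_smul_homogeneous [FiniteDimensional ℝ E] {A : E → F} {j k : ℕ} {h : ℝ → ℝ}
    (hh : ContDiff ℝ (j + k : ℕ) h) (h0 : ∀ i ≤ j + k, iteratedDeriv i h 0 = 0)
    (hA : ∀ x, x ≠ 0 → ContDiffAt ℝ ∞ A x)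
    (hom : ∀ t : ℝ, 0 < t → ∀ x, t ^ k • A (t • x) = A x) :
    (fun x => h ‖x‖ • A x) =o[𝓝 0] fun x : E => ‖x‖ ^ j := by
  obtain ⟨C, hC⟩ := exists_bound_of_homogeneous (fun x hx => (hA x hx).continuousAt) hom
  have hO : (fun x : E => ‖x‖ ^ j * (‖x‖ ^ k * ‖A x‖)) =O[𝓝[≠] 0] fun x : E => ‖x‖ ^ j := by
    refine IsBigO.of_bound C ?_
    filter_upwards [self_mem_nhdsWithin] with x hx
    rw [norm_mul, mul_comm]
    gcongr
    rw [Real.norm_of_nonneg (by positivity)]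
    exact hC x hx
  have ho : (fun x : E => h ‖x‖) =o[𝓝 0] fun x : E => ‖x‖ ^ (j + k) :=
    (isLittleO_pow_of_iteratedDeriv_eq_zero hh h0).comp_tendsto
      (by simpa using (continuous_norm (E := E)).tendsto 0)
  have h1 : (fun x => h ‖x‖ • A x) =o[𝓝[≠] 0] fun x : E => ‖x‖ ^ j := by
    refine IsLittleO.trans_isBigO (IsLittleO.of_norm_left ?_) hO
    simp only [norm_smul, ← mul_assoc, ← pow_add]
    exact (ho.mono nhdsWithin_le_nhds).norm_left.mul_isBigO (isBigO_refl _ _)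
  have hz : h 0 = 0 := by simpa using h0 0 (Nat.zero_le _)
  rw [← nhdsNE_sup_pure (0 : E)]
  refine h1.sup ?_
  rw [isLittleO_pure]
  simp [hz]

/-- A radial function that is flat to order `n + k` at the origin, times a function which is smooth
off the origin and homogeneous of degree `-k`, is `C^n`. -/
theorem contDiff_radial_smul_homogeneous [FiniteDimensional ℝ E] (n : ℕ) :
    ∀ {F : Type} [NormedAddCommGroup F] [NormedSpace ℝ F] {A : E → F} {k : ℕ} {h : ℝ → ℝ},
    ContDiff ℝ (n + k : ℕ) h → (∀ i ≤ n + k, iteratedDeriv i h 0 = 0) →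
    (∀ x, x ≠ 0 → ContDiffAt ℝ ∞ A x) →
    (∀ t : ℝ, 0 < t → ∀ x, t ^ k • A (t • x) = A x) →
    ContDiff ℝ n (fun x => h ‖x‖ • A x) := by
  induction n with
  | zero =>
    intro F _ _ A k h hh h0 hA hom
    rw [Nat.cast_zero, contDiff_zero, continuous_iff_continuousAt]
    intro x
    rcases eq_or_ne x 0 with rfl | hx
    · have hz : h 0 = 0 := by simpa using h0 0 (Nat.zero_le _)
      have := isLittleO_radial_smul_homogeneous hh h0 hA hom
      simp only [pow_zero, isLittleO_one_iff] at this
      simpa [ContinuousAt, hz] using this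
    · exact (hh.continuous.comp continuous_norm).continuousAt.smul (hA x hx).continuousAt
  | succ n ih =>
    intro F _ _ A k h hh h0 hA hom
    have hz : h 0 = 0 := by simpa using h0 0 (Nat.zero_le _)
    have hz' : deriv h 0 = 0 := by simpa using h0 1 (by omega)
    have hd : Differentiable ℝ h := hh.differentiable (by norm_cast; omega)
    have hfd : ∀ x : E, HasFDerivAt (fun x => h ‖x‖ • A x)
        (deriv h ‖x‖ • (fderiv ℝ norm x).smulRight (A x) + h ‖x‖ • fderiv ℝ A x) x := by
      intro x
      rcases eq_or_ne x 0 with rfl | hx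
      · simp only [norm_zero, hz, hz', zero_smul, add_zero]
        have hlit := isLittleO_radial_smul_homogeneous (j := 1) (k := k)
          (hh.of_le (by norm_cast; omega)) (fun i hi => h0 i (by omega)) hA hom
        rw [hasFDerivAt_iff_isLittleO]
        simpa [hz] using IsLittleO.of_norm_right (by simpa using hlit)
      · have hN : HasFDerivAt (norm : E → ℝ) (fderiv ℝ norm x) x :=
          ((contDiffAt_norm ℝ (n := 1) hx).differentiableAt one_ne_zero).hasFDerivAt
        have hAd : HasFDerivAt A (fderiv ℝ A x) x :=
          ((hA x hx).differentiableAt (by simp)).hasFDerivAt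
        have := ((hd ‖x‖).hasDerivAt.comp_hasFDerivAt x hN).smul hAd
        refine this.congr_fderiv ?_
        ext v
        simp [mul_smul, add_comm]
    rw [Nat.cast_succ, contDiff_succ_iff_fderiv]
    refine ⟨fun x => (hfd x).differentiableAt, by simp, ?_⟩
    rw [funext fun x => (hfd x).fderiv]
    refine ContDiff.add (ih (k := k) ?_ ?_ ?_ ?_) (ih (k := k + 1) ?_ ?_ ?_ ?_)
    · have hh' : ContDiff ℝ ((n + k : ℕ) + 1) h := hh.of_le (by norm_cast; omega)
      exact (contDiff_succ_iff_deriv.1 hh').2.2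
    · intro i hi
      rw [← iteratedDeriv_succ']
      exact h0 _ (by omega)
    · intro x hx
      exact ((contDiffAt_norm ℝ (n := ∞) hx).fderiv_right (by simp)).smulRight (hA x hx)
    · intro t ht x
      ext v
      simp only [fderiv_norm_homogeneous t ht, smul_apply, ContinuousLinearMap.smulRight_apply]
      rw [smul_comm, hom t ht]
    · exact hh.of_le (by norm_cast; omega)
    · exact fun i hi => h0 i (by omega)
    · exact fun x hx => (hA x hx).fderiv_right (by simp)
    · exact fderiv_homogeneous hom

end Radial

/-- The odd-order derivatives of an even function vanish at the origin. -/
theorem iteratedDeriv_odd_eq_zero_of_even {f : ℝ → ℝ} (heven : ∀ u, f (-u) = f u) {k : ℕ}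
    (hk : Odd k) : iteratedDeriv k f 0 = 0 := by
  have h := iteratedDeriv_comp_neg k f 0
  simp only [heven, neg_zero, hk.neg_one_pow, neg_smul, one_smul] at h
  linarith

/-- The radial extension of a real-valued even `C^n` function is `C^n`. -/
theorem contDiff_comp_norm_of_even {E : Type} [NormedAddCommGroup E] [InnerProductSpace ℝ E]
    [FiniteDimensional ℝ E] {n : ℕ} {f : ℝ → ℝ} (hf : ContDiff ℝ n f)
    (heven : ∀ u, f (-u) = f u) : ContDiff ℝ n (fun x : E => f ‖x‖) := by
  set c : ℕ → ℝ := fun j => iteratedDeriv (2 * j) f 0 / (2 * j)! with hc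
  set p : ℝ → ℝ := fun r => ∑ j ∈ Finset.range (n + 1), c j * r ^ (2 * j) with hp
  have hpc : ∀ m : ℕ∞, ContDiff ℝ m p := fun m => by fun_prop
  have hpE : ContDiff ℝ n (fun x : E => p ‖x‖) := by
    simp only [hp, pow_mul]
    exact ContDiff.sum fun j _ => contDiff_const.mul ((contDiff_norm_sq ℝ).pow j)
  have hpd : ∀ k ≤ n, iteratedDeriv k p 0 = iteratedDeriv k f 0 := by
    intro k hk
    rw [hp, iteratedDeriv_fun_sum (fun j _ => by fun_prop)]
    simp only [iteratedDeriv_const_mul_field, iteratedDeriv_fun_pow_zero]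
    rcases Nat.even_or_odd' k with ⟨i, rfl | rfl⟩
    · rw [Finset.sum_eq_single_of_mem i (by simp; omega)]
      · simp [hc, Nat.factorial_ne_zero]
      · intro j _ hj
        simp [show 2 * i ≠ 2 * j by omega]
    · rw [iteratedDeriv_odd_eq_zero_of_even heven ⟨i, rfl⟩]
      refine Finset.sum_eq_zero fun j _ => ?_
      simp [show 2 * i + 1 ≠ 2 * j by omega]
  have hflat : ContDiff ℝ n (fun x : E => (f - p) ‖x‖ • (1 : ℝ)) := by
    refine contDiff_radial_smul_homogeneous n (k := 0) (A := fun _ => (1 : ℝ))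
      (hf.sub (hpc n)) (fun k hk => ?_) (fun _ _ => contDiffAt_const) (by simp)
    have hk' : (k : WithTop ℕ∞) ≤ n := by exact_mod_cast hk
    rw [iteratedDeriv_sub (hf.of_le hk').contDiffAt (hpc k).contDiffAt, hpd k hk, sub_self]
  simpa using hflat.add hpE

theorem stmt6 (n d : ℕ) (f : ℝ → ℂ) (hf : ContDiff ℝ n f)
    (heven : ∀ u : ℝ, f (-u) = f u) :
    ContDiff ℝ n (fun μ : EuclideanSpace ℝ (Fin d) => f ‖μ‖) := by
  have hre := contDiff_comp_norm_of_even (E := EuclideanSpace ℝ (Fin d))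
    (Complex.reCLM.contDiff.comp hf) (fun u => by simp [heven])
  have him := contDiff_comp_norm_of_even (E := EuclideanSpace ℝ (Fin d))
    (Complex.imCLM.contDiff.comp hf) (fun u => by simp [heven])
  have h := (Complex.ofRealCLM.contDiff.comp hre).add
    ((Complex.ofRealCLM.contDiff.comp him).mul (contDiff_const (c := Complex.I)))
  simpa [Function.comp_def] using h
end

section
/- Let $\mathfrak{T}(u) = u/\tanh u$ (with $\mathfrak{T}(0)=1$) on $\mathbb{R}$, extended radially to $\mathbb{R}^d$. For every multi-index $\alpha$ there exists $C_\alpha$ such that for all $\mu \in \mathbb{R}^d$ and $t > 0$: $|\partial_\mu^\alpha\, e^{-\mathfrak{T}(t|\mu|)/t}| \leq C_\alpha\, e^{-\mathfrak{T}(t|\mu|)/t}\left(1 + \frac{t}{1+t|\mu|}\right)^{(|\alpha|-1)_+}$. -/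
open Real

/-- `𝔗(u) = u / tanh u`, extended by `𝔗(0) = 1`. -/
noncomputable def Tfun (u : ℝ) : ℝ := if u = 0 then 1 else u / Real.tanh u

open scoped ContDiff

section GeometricBounds

variable {E F : Type*} [NormedAddCommGroup E] [NormedSpace ℝ E]
  [NormedAddCommGroup F] [NormedSpace ℝ F]

/-- If the derivatives of `f` and `g` at `x` grow at most geometrically with the same ratio `B`,
then so do those of `f • g`. -/
lemma norm_iteratedFDeriv_smul_le_geometric {f : E → ℝ} {g : E → F} (hf : ContDiff ℝ ∞ f)
    (hg : ContDiff ℝ ∞ g) {x : E} {A A' B : ℝ} (hB : 0 ≤ B) {n : ℕ}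
    (hfb : ∀ i ≤ n, ‖iteratedFDeriv ℝ i f x‖ ≤ A * B ^ i)
    (hgb : ∀ i ≤ n, ‖iteratedFDeriv ℝ i g x‖ ≤ A' * B ^ i) :
    ∀ i ≤ n, ‖iteratedFDeriv ℝ i (fun y => f y • g y) x‖ ≤ 2 ^ n * (A * A') * B ^ i := by
  intro i hi
  have hA : 0 ≤ A := by simpa using (norm_nonneg _).trans (hfb 0 n.zero_le)
  have hA' : 0 ≤ A' := by simpa using (norm_nonneg _).trans (hgb 0 n.zero_le)
  calc ‖iteratedFDeriv ℝ i (fun y => f y • g y) x‖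
      ≤ ∑ j ∈ Finset.range (i + 1), (i.choose j : ℝ) * ‖iteratedFDeriv ℝ j f x‖ *
          ‖iteratedFDeriv ℝ (i - j) g x‖ :=
        norm_iteratedFDeriv_smul_le hf hg x (mod_cast le_top)
    _ ≤ ∑ j ∈ Finset.range (i + 1), (i.choose j : ℝ) * (A * A' * B ^ i) := by
        refine Finset.sum_le_sum fun j hj => ?_
        have hji : j ≤ i := Nat.lt_succ_iff.1 (Finset.mem_range.1 hj)
        rw [mul_assoc]
        refine mul_le_mul_of_nonneg_left ?_ (Nat.cast_nonneg _)
        calc _ ≤ (A * B ^ j) * (A' * B ^ (i - j)) :=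
              mul_le_mul (hfb j (hji.trans hi)) (hgb _ ((Nat.sub_le _ _).trans hi))
                (norm_nonneg _) (by positivity)
          _ = A * A' * (B ^ j * B ^ (i - j)) := by ring
          _ = A * A' * B ^ i := by rw [pow_mul_pow_sub _ hji]
    _ = 2 ^ i * (A * A') * B ^ i := by
        rw [← Finset.sum_mul, ← Nat.cast_sum, Nat.sum_range_choose]
        push_cast
        ring
    _ ≤ 2 ^ n * (A * A') * B ^ i := by
        gcongr
        norm_num

lemma ContinuousLinearMap.norm_iteratedFDeriv_le_geometric (L : E →L[ℝ] F) {x : E} {ρ : ℝ}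
    (hρ : 0 < ρ) (hx : ‖x‖ ≤ ρ) (i : ℕ) :
    ‖iteratedFDeriv ℝ i L x‖ ≤ ‖L‖ * ρ * ρ⁻¹ ^ i := by
  match i with
  | 0 => simpa using L.le_opNorm_of_le hx
  | 1 =>
    rw [norm_iteratedFDeriv_one, L.fderiv]
    exact le_of_eq (by field_simp)
  | i + 2 =>
    rw [← norm_iteratedFDeriv_fderiv, funext fun y => L.fderiv (x := y)]
    rw [iteratedFDeriv_const_of_ne (by simp)]
    simp only [Pi.zero_apply, norm_zero]
    positivity

end GeometricBounds

section Kernel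

variable {E : Type*} [NormedAddCommGroup E] [InnerProductSpace ℝ E]

lemma norm_iteratedFDeriv_fderiv_norm_sq_le (i : ℕ) {x : E} {ρ : ℝ} (hρ : 0 < ρ) (hx : ‖x‖ ≤ ρ) :
    ‖iteratedFDeriv ℝ i (fderiv ℝ fun y : E => ‖y‖ ^ 2) x‖ ≤ 2 * ρ * ρ⁻¹ ^ i := by
  set L : E →L[ℝ] E →L[ℝ] ℝ := 2 • innerSL ℝ with hL
  have hLn : ‖L‖ ≤ 2 := by
    refine ContinuousLinearMap.opNorm_le_bound _ (by norm_num) fun y => ?_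
    rw [hL, smul_apply, ← Nat.cast_smul_eq_nsmul ℝ, norm_smul, innerSL_apply_norm]
    simp
  rw [fderiv_norm_sq]
  refine (L.norm_iteratedFDeriv_le_geometric hρ hx i).trans ?_
  gcongr

lemma norm_iteratedFDeriv_norm_sq_le (i : ℕ) {x : E} {ρ : ℝ} (hρ : 0 < ρ) (hx : ‖x‖ ≤ ρ) :
    ‖iteratedFDeriv ℝ i (fun y : E => ‖y‖ ^ 2) x‖ ≤ 2 * ρ ^ 2 * ρ⁻¹ ^ i := by
  match i with
  | 0 =>
    simp only [norm_iteratedFDeriv_zero, norm_pow, norm_norm, pow_zero, mul_one]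
    nlinarith [norm_nonneg x]
  | i + 1 =>
    rw [← norm_iteratedFDeriv_fderiv]
    refine (norm_iteratedFDeriv_fderiv_norm_sq_le i hρ hx).trans (le_of_eq ?_)
    rw [pow_succ]
    linear_combination (-2 * ρ * ρ⁻¹ ^ i) * mul_inv_cancel₀ hρ.ne'

lemma contDiff_inv_norm_sq_add {a : ℝ} (ha : 0 < a) :
    ContDiff ℝ ∞ fun y : E => (‖y‖ ^ 2 + a)⁻¹ :=
  ((contDiff_norm_sq ℝ).add contDiff_const).inv fun y => by positivity

lemma norm_iteratedFDeriv_inv_norm_sq_add_le (n : ℕ) :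
    ∃ C : ℝ, 0 < C ∧ ∀ a : ℝ, 1 ≤ a → ∀ x : E, ∀ i ≤ n,
      ‖iteratedFDeriv ℝ i (fun y : E => (‖y‖ ^ 2 + a)⁻¹) x‖ ≤
        C * (‖x‖ ^ 2 + a)⁻¹ * (1 + ‖x‖)⁻¹ ^ i := by
  induction n with
  | zero =>
    refine ⟨1, one_pos, fun a ha x i hi => ?_⟩
    obtain rfl : i = 0 := by lia
    have : 0 ≤ ‖x‖ ^ 2 + a := by positivity
    simp [abs_of_nonneg this]
  | succ n ih =>
    obtain ⟨C, hC, h⟩ := ih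
    refine ⟨max C (2 ^ n * (2 ^ n * (C * C)) * 4), by positivity, fun a ha x i hi => ?_⟩
    have ha0 : 0 < a := by linarith
    set w : E → ℝ := fun y => (‖y‖ ^ 2 + a)⁻¹ with hw
    have hwx : 0 < w x := by positivity
    have hws : ContDiff ℝ ∞ w := contDiff_inv_norm_sq_add ha0
    rcases Nat.lt_or_ge n i with hni | hni
    · obtain rfl : i = n + 1 := by lia
      have hρ : 0 < 1 + ‖x‖ := by positivity
      have hq : ContDiff ℝ ∞ fun y : E => ‖y‖ ^ 2 := contDiff_norm_sq ℝ
      have hfd : fderiv ℝ w = -fun y => (w y • w y) • fderiv ℝ (fun y : E => ‖y‖ ^ 2) y := by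
        funext y
        have hy : ‖y‖ ^ 2 + a ≠ 0 := by positivity
        have h1 : HasFDerivAt (fun y : E => ‖y‖ ^ 2 + a) (fderiv ℝ (fun y : E => ‖y‖ ^ 2) y) y :=
          ((hq.differentiable (by simp)).differentiableAt.hasFDerivAt).add_const a
        have h2 := ((hasDerivAt_inv hy).comp_hasFDerivAt y h1).fderiv
        rw [hw]
        refine h2.trans ?_
        simp only [Pi.neg_apply, smul_eq_mul, ← neg_smul]
        congr 1
        field_simp
      have h2 := norm_iteratedFDeriv_smul_le_geometric hws hws (x := x)
        (B := (1 + ‖x‖)⁻¹) (by positivity) (h a ha x) (h a ha x)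
      have h3 := norm_iteratedFDeriv_smul_le_geometric (hws.smul hws)
        (hq.fderiv_right (m := ∞) (by simp)) (x := x) (B := (1 + ‖x‖)⁻¹) (by positivity) h2
        (fun i _ => norm_iteratedFDeriv_fderiv_norm_sq_le i hρ (by linarith)) n le_rfl
      rw [← norm_iteratedFDeriv_fderiv, hfd, iteratedFDeriv_neg, Pi.neg_apply, norm_neg]
      refine h3.trans ?_
      have h4 : w x * (1 + ‖x‖) ^ 2 ≤ 2 := by
        rw [hw, inv_mul_le_iff₀ (by positivity)]
        nlinarith [sq_nonneg (‖x‖ - 1)]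
      calc _ = 2 ^ n * (2 ^ n * (C * C)) * 2 * w x * (w x * (1 + ‖x‖) ^ 2)
              * (1 + ‖x‖)⁻¹ ^ (n + 1) := by
              rw [pow_succ]
              linear_combination (-2 ^ n * (2 ^ n * (C * C)) * 2 * w x ^ 2 * (1 + ‖x‖) *
                (1 + ‖x‖)⁻¹ ^ n) * mul_inv_cancel₀ hρ.ne'
        _ ≤ 2 ^ n * (2 ^ n * (C * C)) * 2 * w x * 2 * (1 + ‖x‖)⁻¹ ^ (n + 1) := by gcongr
        _ = 2 ^ n * (2 ^ n * (C * C)) * 4 * w x * (1 + ‖x‖)⁻¹ ^ (n + 1) := by ring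
        _ ≤ _ := by
          gcongr
          exact le_max_right _ _
    · refine (h a ha x i hni).trans ?_
      gcongr
      exact le_max_left _ _

end Kernel

/-- The Mittag-Leffler expansion of `coth`. -/
lemma tanh_inv_sub_inv_eq_tsum {u : ℝ} (hu : u ≠ 0) :
    (Real.tanh u)⁻¹ - u⁻¹ = 2 * u * ∑' n : ℕ, (u ^ 2 + (π * (n + 1)) ^ 2)⁻¹ := by
  have hπ : (π : ℂ) ≠ 0 := by exact_mod_cast Real.pi_ne_zero
  have huC : (u : ℂ) ≠ 0 := by exact_mod_cast hu
  have hz : (u / π : ℂ) * Complex.I ∈ Complex.integerComplement := by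
    rintro ⟨n, hn⟩
    have h := congrArg Complex.im hn
    rw [← Complex.ofReal_div] at h
    simp only [Complex.intCast_im, Complex.im_ofReal_mul, Complex.I_im,
      mul_one] at h
    exact div_ne_zero hu Real.pi_ne_zero h.symm
  have h := cot_series_rep' hz
  have hcot : Complex.cot (π * ((u / π : ℂ) * Complex.I)) = -Complex.I * (Complex.tanh u)⁻¹ := by
    rw [show (π : ℂ) * ((u / π : ℂ) * Complex.I) = u * Complex.I by field_simp,
      ← Complex.tan_inv_eq_cot, Complex.tan_mul_I, mul_inv, Complex.inv_I]
    ring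
  have hterm : ∀ n : ℕ, (1 / ((u / π : ℂ) * Complex.I - (n + 1)) +
      1 / ((u / π : ℂ) * Complex.I + (n + 1))) =
      (-Complex.I * π * (2 * u)) * ((u ^ 2 + (π * (n + 1)) ^ 2 : ℝ)⁻¹ : ℝ) := by
    intro n
    have h1 : (u / π : ℂ) * Complex.I - (n + 1) ≠ 0 := by
      simpa [sub_eq_add_neg] using Complex.integerComplement_add_ne_zero hz (-(n + 1) : ℤ)
    have h2 : (u / π : ℂ) * Complex.I + (n + 1) ≠ 0 := by
      simpa using Complex.integerComplement_add_ne_zero hz ((n : ℤ) + 1)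
    have h3 : (u ^ 2 + (π * (n + 1)) ^ 2 : ℂ) ≠ 0 := by
      exact_mod_cast (by positivity : (u ^ 2 + (π * (n + 1)) ^ 2 : ℝ) ≠ 0)
    have h4 : ((u / π : ℂ) * Complex.I - (n + 1)) * ((u / π : ℂ) * Complex.I + (n + 1)) =
        -(u ^ 2 + (π * (n + 1)) ^ 2) / π ^ 2 := by
      field_simp
      ring_nf
      rw [Complex.I_sq]
      ring
    rw [div_add_div _ _ h1 h2, h4]
    push_cast
    field_simp
    ring
  rw [hcot, tsum_congr hterm, tsum_mul_left, ← Complex.ofReal_tsum, ← Complex.ofReal_tanh] at h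
  have hI : (1 : ℂ) / ((u / π : ℂ) * Complex.I) = -Complex.I * π * (u : ℂ)⁻¹ := by
    rw [div_eq_iff (by simp [huC, hπ])]
    field_simp
    simp
  rw [hI] at h
  have h5 : (-Complex.I * π) * ((Real.tanh u : ℂ)⁻¹ - (u : ℂ)⁻¹) = (-Complex.I * π) *
      (2 * u * ((∑' n : ℕ, (u ^ 2 + (π * (n + 1)) ^ 2)⁻¹ : ℝ) : ℂ)) := by
    linear_combination h
  have h6 := mul_left_cancel₀ (by simp [hπ]) h5
  exact_mod_cast h6

lemma tanh_inv_le {u : ℝ} (hu : 0 < u) : (Real.tanh u)⁻¹ ≤ 1 + u⁻¹ := by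
  have hs : 0 < Real.sinh u := Real.sinh_pos_iff.2 hu
  have h1 : u ≤ Real.sinh u := Real.self_le_sinh_iff.2 hu.le
  rw [Real.tanh_eq_sinh_div_cosh, inv_div, div_le_iff₀ hs]
  have h2 : Real.exp (-u) ≤ 1 := Real.exp_le_one_iff.2 (by linarith)
  have h3 := Real.cosh_sub_sinh u
  have h4 : 1 ≤ u⁻¹ * Real.sinh u := by
    rw [inv_mul_eq_div, one_le_div hu]; exact h1
  linarith

lemma Tfun_eq_one_add (u : ℝ) :
    Tfun u = 1 + 2 * (u ^ 2 * ∑' n : ℕ, (u ^ 2 + (π * (n + 1)) ^ 2)⁻¹) := by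
  by_cases hu : u = 0
  · simp [Tfun, hu]
  · have h := tanh_inv_sub_inv_eq_tsum hu
    rw [Tfun, if_neg hu, div_eq_mul_inv, sub_eq_iff_eq_add.1 h]
    field_simp
    ring

lemma summable_inv_pi_mul_sq : Summable fun n : ℕ => ((π * (n + 1)) ^ 2)⁻¹ := by
  have h := (summable_nat_add_iff 1).2 (Real.summable_nat_pow_inv (p := 2).2 one_lt_two)
  refine (h.mul_left ((π ^ 2)⁻¹)).congr fun n => ?_
  push_cast
  rw [mul_pow, mul_inv]

lemma summable_inv_sq_add (u : ℝ) :
    Summable fun n : ℕ => (u ^ 2 + (π * (n + 1)) ^ 2)⁻¹ :=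
  summable_inv_pi_mul_sq.of_nonneg_of_le (fun n => by positivity) fun n => by
    exact inv_anti₀ (by positivity) (le_add_of_nonneg_left (sq_nonneg u))

lemma tsum_inv_sq_add_le :
    ∃ C : ℝ, 0 < C ∧ ∀ u : ℝ, 0 ≤ u →
      ∑' n : ℕ, (u ^ 2 + (π * (n + 1)) ^ 2)⁻¹ ≤ C * (1 + u)⁻¹ := by
  set S := ∑' n : ℕ, ((π * (n + 1)) ^ 2)⁻¹ with hS
  have hS0 : 0 ≤ S := tsum_nonneg fun n => by positivity
  refine ⟨S + 1, by positivity, fun u hu => ?_⟩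
  set K := ∑' n : ℕ, (u ^ 2 + (π * (n + 1)) ^ 2)⁻¹ with hK
  have h1 : K ≤ S := by
    refine (summable_inv_sq_add u).tsum_le_tsum (fun n => ?_) summable_inv_pi_mul_sq
    exact inv_anti₀ (by positivity) (le_add_of_nonneg_left (sq_nonneg u))
  have h2 : u * K ≤ 1 := by
    rcases hu.eq_or_lt with rfl | hu
    · simp
    · have h3 := tanh_inv_sub_inv_eq_tsum hu.ne'
      have h4 := tanh_inv_le hu
      linarith
  rw [← div_eq_mul_inv, le_div_iff₀ (by positivity)]
  linarith

section Symbol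

variable {E : Type*} [NormedAddCommGroup E] [InnerProductSpace ℝ E]

lemma one_le_pi_mul_sq (n : ℕ) : 1 ≤ (π * (n + 1)) ^ 2 := by
  have h1 : (1 : ℝ) ≤ n + 1 := by linarith [n.cast_nonneg (α := ℝ)]
  have h2 : (1 : ℝ) ≤ π := by linarith [Real.pi_gt_three]
  exact one_le_pow₀ (one_le_mul_of_one_le_of_one_le h2 h1)

lemma exists_norm_iteratedFDeriv_le_inv (k : ℕ) :
    ∃ C : ℝ, 0 < C ∧ ∀ (n : ℕ) (x : E),
      ‖iteratedFDeriv ℝ k (fun y : E => (‖y‖ ^ 2 + (π * (n + 1)) ^ 2)⁻¹) x‖ ≤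
        C * ((π * (n + 1)) ^ 2)⁻¹ := by
  obtain ⟨C, hC, h⟩ := norm_iteratedFDeriv_inv_norm_sq_add_le (E := E) k
  refine ⟨C, hC, fun n x => (h _ (one_le_pi_mul_sq n) x k le_rfl).trans ?_⟩
  have h1 : (1 + ‖x‖)⁻¹ ^ k ≤ 1 :=
    pow_le_one₀ (by positivity) (inv_le_one_of_one_le₀ (by linarith [norm_nonneg x]))
  refine (mul_le_of_le_one_right (by positivity) h1).trans ?_
  gcongr
  exact le_add_of_nonneg_left (sq_nonneg ‖x‖)

lemma contDiff_tsum_inv_norm_sq_add :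
    ContDiff ℝ ∞ fun y : E => ∑' n : ℕ, (‖y‖ ^ 2 + (π * (n + 1)) ^ 2)⁻¹ := by
  choose C _ h using exists_norm_iteratedFDeriv_le_inv (E := E)
  exact contDiff_tsum (N := ⊤) (fun n => contDiff_inv_norm_sq_add (by positivity))
    (fun k _ => summable_inv_pi_mul_sq.mul_left (C k)) (fun k n x _ => h k n x)

lemma norm_iteratedFDeriv_tsum_inv_le (m : ℕ) :
    ∃ C : ℝ, 0 < C ∧ ∀ x : E, ∀ i ≤ m,
      ‖iteratedFDeriv ℝ i (fun y : E => ∑' n : ℕ, (‖y‖ ^ 2 + (π * (n + 1)) ^ 2)⁻¹) x‖ ≤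
        C * (1 + ‖x‖)⁻¹ * (1 + ‖x‖)⁻¹ ^ i := by
  obtain ⟨C, hC, h⟩ := norm_iteratedFDeriv_inv_norm_sq_add_le (E := E) m
  obtain ⟨C', hC', h'⟩ := tsum_inv_sq_add_le
  refine ⟨C * C', by positivity, fun x i hi => ?_⟩
  choose D _ hD using exists_norm_iteratedFDeriv_le_inv (E := E)
  rw [iteratedFDeriv_tsum_apply (N := ⊤) (fun n => contDiff_inv_norm_sq_add (by positivity))
    (fun k _ => summable_inv_pi_mul_sq.mul_left (D k)) (fun k n x _ => hD k n x) le_top]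
  refine (tsum_of_norm_bounded (((summable_inv_sq_add ‖x‖).mul_left C).mul_right _).hasSum
    fun n => h _ (one_le_pi_mul_sq n) x i hi).trans ?_
  rw [tsum_mul_right, tsum_mul_left, mul_assoc C C']
  gcongr
  exact h' _ (norm_nonneg x)

/-- The part of the radial extension of `𝔗` that is not constant: `𝔗(‖y‖) = 1 + 2 Φ(y)`. -/
noncomputable def radialPart (y : E) : ℝ :=
  ‖y‖ ^ 2 • ∑' n : ℕ, (‖y‖ ^ 2 + (π * (n + 1)) ^ 2)⁻¹

lemma contDiff_radialPart : ContDiff ℝ ∞ (radialPart : E → ℝ) :=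
  (contDiff_norm_sq ℝ).smul contDiff_tsum_inv_norm_sq_add

/-- `radialPart` is a symbol of order one. -/
lemma norm_iteratedFDeriv_radialPart_le (m : ℕ) :
    ∃ C : ℝ, 0 < C ∧ ∀ x : E, ∀ i ≤ m,
      ‖iteratedFDeriv ℝ i radialPart x‖ ≤ C * (1 + ‖x‖) * (1 + ‖x‖)⁻¹ ^ i := by
  obtain ⟨C, hC, h⟩ := norm_iteratedFDeriv_tsum_inv_le (E := E) m
  refine ⟨2 ^ m * 2 * C, by positivity, fun x i hi => ?_⟩
  have hρ : 0 < 1 + ‖x‖ := by positivity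
  refine (norm_iteratedFDeriv_smul_le_geometric (contDiff_norm_sq ℝ)
    contDiff_tsum_inv_norm_sq_add (x := x) (B := (1 + ‖x‖)⁻¹) (by positivity)
    (fun i _ => norm_iteratedFDeriv_norm_sq_le i hρ (by linarith)) (h x) i hi).trans
    (le_of_eq ?_)
  linear_combination (2 ^ m * 2 * C * (1 + ‖x‖) * (1 + ‖x‖)⁻¹ ^ i) * mul_inv_cancel₀ hρ.ne'

lemma neg_Tfun_div_eq (t : ℝ) (y : E) :
    -Tfun (t * ‖y‖) / t = (-2 / t) • radialPart (t • y) + -1 / t := by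
  have h : (t * ‖y‖) ^ 2 = ‖t • y‖ ^ 2 := by rw [norm_smul, mul_pow, mul_pow, Real.norm_eq_abs, sq_abs]
  rw [Tfun_eq_one_add, h, radialPart, smul_eq_mul, smul_eq_mul]
  ring

lemma norm_iteratedFDeriv_fderiv_Tfun_le (m : ℕ) :
    ∃ C : ℝ, 0 < C ∧ ∀ t : ℝ, 0 < t → ∀ x : E, ∀ i ≤ m,
      ‖iteratedFDeriv ℝ i (fderiv ℝ fun y : E => -Tfun (t * ‖y‖) / t) x‖ ≤
        C * (1 + t / (1 + t * ‖x‖)) ^ i := by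
  obtain ⟨C, hC, h⟩ := norm_iteratedFDeriv_radialPart_le (E := E) (m + 1)
  refine ⟨2 * C, by positivity, fun t ht x i hi => ?_⟩
  have hρ : 0 < 1 + t * ‖x‖ := by positivity
  have hfd : (fderiv ℝ fun y : E => -Tfun (t * ‖y‖) / t) =
      fderiv ℝ fun y : E => (-2 / t) • radialPart (t • y) := by
    funext y
    simp only [neg_Tfun_div_eq]
    exact fderiv_add_const _
  have hs : ContDiff ℝ ∞ fun y : E => radialPart (t • y) :=
    contDiff_radialPart.comp (contDiff_const_smul t)
  have hb := h (t • x) (i + 1) (by lia)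
  rw [norm_smul, Real.norm_of_nonneg ht.le] at hb
  rw [hfd, norm_iteratedFDeriv_fderiv,
    iteratedFDeriv_const_smul_apply' (hs.of_le (mod_cast le_top)).contDiffAt,
    iteratedFDeriv_comp_const_smul t (contDiff_radialPart.of_le (mod_cast le_top)), norm_smul,
    norm_smul, norm_pow, Real.norm_of_nonneg ht.le, norm_div, norm_neg, Real.norm_ofNat,
    Real.norm_of_nonneg ht.le]
  calc 2 / t * (t ^ (i + 1) * ‖iteratedFDeriv ℝ (i + 1) radialPart (t • x)‖)
      ≤ 2 / t * (t ^ (i + 1) * (C * (1 + t * ‖x‖) * (1 + t * ‖x‖)⁻¹ ^ (i + 1))) := by gcongr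
    _ = 2 * C * (t / (1 + t * ‖x‖)) ^ i := by
        rw [div_pow, inv_pow, pow_succ, pow_succ]
        field_simp
    _ ≤ 2 * C * (1 + t / (1 + t * ‖x‖)) ^ i := by
        gcongr
        linarith

lemma contDiff_neg_Tfun_div (t : ℝ) : ContDiff ℝ ∞ fun y : E => -Tfun (t * ‖y‖) / t := by
  simp only [neg_Tfun_div_eq]
  exact ((contDiff_radialPart.comp (contDiff_const_smul t)).const_smul (-2 / t)).add contDiff_const

end Symbol

section Exponential

variable {E : Type*} [NormedAddCommGroup E] [NormedSpace ℝ E]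

/-- If the derivatives of positive order `i + 1` of `h` at `x` are bounded by `A * B ^ i`, then
those of `exp ∘ h` are bounded by a multiple of `exp (h x) * B ^ i`. -/
lemma norm_iteratedFDeriv_exp_comp_le (A : ℝ) (n : ℕ) :
    ∃ C : ℝ, 0 < C ∧ ∀ (h : E → ℝ) (x : E) (B : ℝ), ContDiff ℝ ∞ h → 1 ≤ B →
      (∀ i ≤ n, ‖iteratedFDeriv ℝ i (fderiv ℝ h) x‖ ≤ A * B ^ i) → ∀ i ≤ n,
        ‖iteratedFDeriv ℝ i (fun y => Real.exp (h y)) x‖ ≤ C * Real.exp (h x) * B ^ (i - 1) := by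
  induction n with
  | zero =>
    refine ⟨1, one_pos, fun h x B _ _ _ i hi => ?_⟩
    obtain rfl : i = 0 := by lia
    simp
  | succ n ih =>
    obtain ⟨C, hC, hb⟩ := ih
    refine ⟨max C (2 ^ n * (C * A)), by positivity, fun h x B hh hB hA' i hi => ?_⟩
    have hb' := hb h x B hh hB fun i hi => hA' i (by lia)
    rcases Nat.lt_or_ge n i with hni | hni
    · obtain rfl : i = n + 1 := by lia
      have hfd : (fderiv ℝ fun y => Real.exp (h y)) =
          fun y => Real.exp (h y) • fderiv ℝ h y := by
        funext y
        exact fderiv_exp (hh.differentiable (by simp)).differentiableAt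
      rw [← norm_iteratedFDeriv_fderiv, hfd, Nat.add_sub_cancel]
      refine (norm_iteratedFDeriv_smul_le_geometric (Real.contDiff_exp.comp hh)
        (hh.fderiv_right (m := ∞) (by simp)) (x := x) (A := C * Real.exp (h x)) (A' := A)
        (B := B) (by linarith) (fun i hi => (hb' i hi).trans ?_)
        (fun i hi => hA' i (by lia)) n le_rfl).trans ?_
      · gcongr
        exact Nat.sub_le _ _
      · calc _ = 2 ^ n * (C * A) * Real.exp (h x) * B ^ n := by ring
          _ ≤ _ := by
            gcongr
            exact le_max_right _ _
    · refine (hb' i hni).trans ?_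
      gcongr
      exact le_max_left _ _

end Exponential

theorem stmt13 (d k : ℕ) :
    ∃ C : ℝ, 0 < C ∧ ∀ t : ℝ, 0 < t → ∀ μ : EuclideanSpace ℝ (Fin d),
      ‖iteratedFDeriv ℝ k
          (fun ν : EuclideanSpace ℝ (Fin d) => Real.exp (-Tfun (t * ‖ν‖) / t)) μ‖ ≤
        C * Real.exp (-Tfun (t * ‖μ‖) / t) * (1 + t / (1 + t * ‖μ‖)) ^ (k - 1) := by
  obtain ⟨A, -, h⟩ := norm_iteratedFDeriv_fderiv_Tfun_le (E := EuclideanSpace ℝ (Fin d)) k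
  obtain ⟨C, hC, hb⟩ := norm_iteratedFDeriv_exp_comp_le (E := EuclideanSpace ℝ (Fin d)) A k
  refine ⟨C, hC, fun t ht μ => ?_⟩
  have hB : 0 ≤ t / (1 + t * ‖μ‖) := by positivity
  exact hb _ μ _ (contDiff_neg_Tfun_div t) (by linarith) (h t ht μ) k le_rfl
end

section
/- Let $\mathfrak{S}(u) = u/\sinh u$ (with $\mathfrak{S}(0)=1$), extended radially to $\mathbb{R}^d$. For every $\gamma \in \mathbb{C}$ and multi-index $\alpha$, there is $C_{\alpha,\gamma}$ such that for all $\mu \in \mathbb{R}^d$ and $t > 0$: $|\partial_\mu^\alpha [\mathfrak{S}(t|\mu|)^\gamma]| \leq C_{\alpha,\gamma}\, t^{|\alpha|}\, (1 + t|\mu|)^{\mathrm{Re}\,\gamma}\, e^{-t|\mu|\,\mathrm{Re}\,\gamma}$. -/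
open Real

/-- `𝔖(u) = u / sinh u`, extended by `𝔖(0) = 1`. -/
noncomputable def Sfun (u : ℝ) : ℝ := if u = 0 then 1 else u / Real.sinh u

open scoped Nat in
/-- Taylor coefficients of the `m`-th derivative of the entire function
`s ↦ sinh (√s) / √s = ∑ sⁿ / (2n+1)!`. -/
noncomputable def sinhcCoeff (m n : ℕ) : ℝ :=
  ((n + m)! : ℝ) / ((n ! : ℝ) * ((2 * n + 2 * m + 1)! : ℝ))

/-- The `m`-th derivative of the entire function `s ↦ sinh (√s) / √s`. -/
noncomputable def sinhcDeriv (m : ℕ) (s : ℝ) : ℝ := ∑' n, sinhcCoeff m n * s ^ n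

lemma sinhcCoeff_pos (m n : ℕ) : 0 < sinhcCoeff m n := by
  unfold sinhcCoeff
  positivity

lemma sinhcCoeff_le (m n : ℕ) : sinhcCoeff m n ≤ ((n.factorial : ℕ) : ℝ)⁻¹ := by
  unfold sinhcCoeff
  have h : ((n + m).factorial : ℝ) ≤ ((2 * n + 2 * m + 1).factorial : ℝ) := by
    exact_mod_cast Nat.factorial_le (by omega)
  have h1 : (0 : ℝ) < ((2 * n + 2 * m + 1).factorial : ℝ) := by positivity
  have h2 : (0 : ℝ) < (n.factorial : ℝ) := by positivity
  rw [div_le_iff₀ (by positivity), inv_mul_cancel_left₀ h2.ne']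
  exact h

lemma sinhcCoeff_succ_right (m n : ℕ) :
    ((n : ℝ) + 1) * sinhcCoeff m (n + 1) = sinhcCoeff (m + 1) n := by
  unfold sinhcCoeff
  rw [show n + 1 + m = n + (m + 1) by ring,
    show 2 * (n + 1) + 2 * m + 1 = 2 * n + 2 * (m + 1) + 1 by ring,
    Nat.factorial_succ n]
  push_cast
  field_simp

lemma sinhcCoeff_succ_left (m n : ℕ) :
    2 * (2 * (n : ℝ) + 2 * m + 3) * sinhcCoeff (m + 1) n = sinhcCoeff m n := by
  unfold sinhcCoeff
  rw [show n + (m + 1) = (n + m) + 1 by ring,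
    show 2 * n + 2 * (m + 1) + 1 = ((2 * n + 2 * m + 1) + 1) + 1 by ring,
    Nat.factorial_succ (n + m), Nat.factorial_succ (2 * n + 2 * m + 1 + 1),
    Nat.factorial_succ (2 * n + 2 * m + 1)]
  push_cast
  field_simp
  ring

lemma summable_sinhcCoeff (m : ℕ) (s : ℝ) : Summable fun n => sinhcCoeff m n * s ^ n := by
  refine Summable.of_norm_bounded (Real.summable_pow_div_factorial |s|) fun n => ?_
  rw [norm_mul, norm_pow, Real.norm_eq_abs, Real.norm_eq_abs, abs_of_pos (sinhcCoeff_pos m n),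
    div_eq_inv_mul]
  exact mul_le_mul_of_nonneg_right (sinhcCoeff_le m n) (by positivity)

lemma hasDerivAt_sinhcDeriv (m : ℕ) (s : ℝ) :
    HasDerivAt (sinhcDeriv m) (sinhcDeriv (m + 1) s) s := by
  have hR : (0 : ℝ) ≤ |s| + 1 := by positivity
  have hsucc : ∀ (r : ℝ) (n : ℕ), sinhcCoeff m (n + 1) * (((n + 1 : ℕ) : ℝ) * r ^ (n + 1 - 1)) =
      sinhcCoeff (m + 1) n * r ^ n := by
    intro r n
    rw [← sinhcCoeff_succ_right]
    push_cast [Nat.add_sub_cancel]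
    ring
  have hsum : ∀ r : ℝ, Summable fun n : ℕ => sinhcCoeff m n * ((n : ℝ) * r ^ (n - 1)) := by
    intro r
    rw [← summable_nat_add_iff 1]
    exact (summable_sinhcCoeff (m + 1) r).congr fun n => (hsucc r n).symm
  have key := hasDerivAt_tsum_of_isPreconnected (t := Metric.ball (0 : ℝ) (|s| + 1))
    (g := fun n y => sinhcCoeff m n * y ^ n)
    (g' := fun n y => sinhcCoeff m n * ((n : ℝ) * y ^ (n - 1))) (y₀ := 0) (y := s)
    (hsum (|s| + 1)) Metric.isOpen_ball (convex_ball _ _).isPreconnected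
    (fun n y _ => (hasDerivAt_pow n y).const_mul _)
    (fun n y hy => by
      have hy' : |y| ≤ |s| + 1 := by simpa using (Metric.mem_ball.1 hy).le
      rw [norm_mul, norm_mul, norm_pow, Real.norm_eq_abs, Real.norm_eq_abs, Real.norm_eq_abs,
        abs_of_pos (sinhcCoeff_pos m n), Nat.abs_cast]
      have := sinhcCoeff_pos m n
      gcongr)
    (Metric.mem_ball_self (by positivity)) (summable_sinhcCoeff m 0) (by simp)
  have e : ∑' n : ℕ, sinhcCoeff m n * ((n : ℝ) * s ^ (n - 1)) = sinhcDeriv (m + 1) s := by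
    rw [(hsum s).tsum_eq_zero_add]
    simp only [hsucc]
    simp [sinhcDeriv]
  rw [e] at key
  exact key

lemma contDiff_sinhcDeriv (N : ℕ) : ∀ m, ContDiff ℝ N (sinhcDeriv m) := by
  induction N with
  | zero =>
    intro m
    exact contDiff_zero.2 (continuous_iff_continuousAt.2
      fun s => (hasDerivAt_sinhcDeriv m s).continuousAt)
  | succ N ih =>
    intro m
    push_cast
    refine contDiff_succ_iff_deriv.2 ⟨fun s => (hasDerivAt_sinhcDeriv m s).differentiableAt,
      by simp, ?_⟩
    rw [show deriv (sinhcDeriv m) = sinhcDeriv (m + 1) from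
      funext fun s => (hasDerivAt_sinhcDeriv m s).deriv]
    exact ih _

lemma sinhcDeriv_nonneg (m : ℕ) {s : ℝ} (hs : 0 ≤ s) : 0 ≤ sinhcDeriv m s :=
  tsum_nonneg fun n => mul_nonneg (sinhcCoeff_pos m n).le (pow_nonneg hs n)

lemma mul_sinhcDeriv_succ_le (m : ℕ) (r : ℝ) :
    (1 + r) * sinhcDeriv (m + 1) (r ^ 2) ≤ 4 * sinhcDeriv m (r ^ 2) := by
  have h0 := summable_sinhcCoeff m (r ^ 2)
  have h1 := (summable_nat_add_iff 1).2 h0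
  have h2 : ∑' n, sinhcCoeff m (n + 1) * (r ^ 2) ^ (n + 1) ≤ sinhcDeriv m (r ^ 2) := by
    rw [sinhcDeriv, h0.tsum_eq_zero_add]
    have := sinhcCoeff_pos m 0
    simp
    positivity
  have h3 : (1 + r) * sinhcDeriv (m + 1) (r ^ 2) ≤
      2 * ∑' n, (sinhcCoeff m n * (r ^ 2) ^ n + sinhcCoeff m (n + 1) * (r ^ 2) ^ (n + 1)) := by
    rw [sinhcDeriv, ← tsum_mul_left, ← tsum_mul_left]
    refine Summable.tsum_le_tsum (fun n => ?_)
      ((summable_sinhcCoeff (m + 1) (r ^ 2)).mul_left _) ((h0.add h1).mul_left _)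
    rw [← sinhcCoeff_succ_left m n]
    have e : sinhcCoeff m (n + 1) = sinhcCoeff (m + 1) n / ((n : ℝ) + 1) := by
      rw [← sinhcCoeff_succ_right]
      field_simp
    rw [e]
    have hc := sinhcCoeff_pos (m + 1) n
    have hmain : 1 + r ≤ 2 * (2 * (2 * (n : ℝ) + 2 * m + 3) + r ^ 2 / ((n : ℝ) + 1)) := by
      have hn : (0 : ℝ) < (n : ℝ) + 1 := by positivity
      have hm : (0 : ℝ) ≤ m := by positivity
      have : r ≤ ((n : ℝ) + 1) + r ^ 2 / ((n : ℝ) + 1) := by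
        rw [← sub_le_iff_le_add', le_div_iff₀ hn]
        nlinarith [sq_nonneg (r - ((n : ℝ) + 1))]
      have h4 : 0 ≤ r ^ 2 / ((n : ℝ) + 1) := by positivity
      linarith
    calc (1 + r) * (sinhcCoeff (m + 1) n * (r ^ 2) ^ n)
        ≤ 2 * (2 * (2 * (n : ℝ) + 2 * m + 3) + r ^ 2 / ((n : ℝ) + 1)) *
          (sinhcCoeff (m + 1) n * (r ^ 2) ^ n) := by gcongr
      _ = _ := by ring
  rw [h0.tsum_add h1] at h3
  change _ ≤ 2 * (sinhcDeriv m (r ^ 2) + _) at h3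
  linarith

lemma one_add_pow_mul_sinhcDeriv_le (m : ℕ) {r : ℝ} (hr : 0 ≤ r) :
    (1 + r) ^ m * sinhcDeriv m (r ^ 2) ≤ 4 ^ m * sinhcDeriv 0 (r ^ 2) := by
  induction m with
  | zero => simp
  | succ m ih =>
    calc (1 + r) ^ (m + 1) * sinhcDeriv (m + 1) (r ^ 2)
        = (1 + r) ^ m * ((1 + r) * sinhcDeriv (m + 1) (r ^ 2)) := by ring
      _ ≤ (1 + r) ^ m * (4 * sinhcDeriv m (r ^ 2)) := by
        exact mul_le_mul_of_nonneg_left (mul_sinhcDeriv_succ_le m r) (by positivity)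
      _ = 4 * ((1 + r) ^ m * sinhcDeriv m (r ^ 2)) := by ring
      _ ≤ 4 * (4 ^ m * sinhcDeriv 0 (r ^ 2)) := by gcongr
      _ = _ := by ring

lemma mul_sinhcDeriv_zero (u : ℝ) : u * sinhcDeriv 0 (u ^ 2) = Real.sinh u := by
  rw [Real.sinh_eq_tsum, sinhcDeriv, ← tsum_mul_left]
  congr 1 with n
  simp only [sinhcCoeff, Nat.add_zero, Nat.mul_zero]
  have : (n.factorial : ℝ) ≠ 0 := by positivity
  field_simp
  ring

lemma sinhcDeriv_zero_zero : sinhcDeriv 0 0 = 1 := by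
  rw [sinhcDeriv, tsum_eq_single 0]
  · simp [sinhcCoeff]
  · intro n hn
    simp [hn]

lemma sinhcDeriv_zero_pos {s : ℝ} (hs : 0 ≤ s) : 0 < sinhcDeriv 0 s := by
  refine (summable_sinhcCoeff 0 s).tsum_pos
    (fun n => mul_nonneg (sinhcCoeff_pos 0 n).le (pow_nonneg hs n)) 0 ?_
  simp [sinhcCoeff]

lemma Sfun_eq_inv (u : ℝ) : Sfun u = (sinhcDeriv 0 (u ^ 2))⁻¹ := by
  rcases eq_or_ne u 0 with rfl | hu
  · simp [Sfun, sinhcDeriv_zero_zero]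
  · rw [Sfun, if_neg hu, ← mul_sinhcDeriv_zero]
    have := sinhcDeriv_zero_pos (sq_nonneg u)
    field_simp

lemma sinhcDeriv_zero_le {u : ℝ} (hu : 0 ≤ u) :
    (1 + u) * Real.exp (-u) * sinhcDeriv 0 (u ^ 2) ≤ 2 := by
  rcases hu.eq_or_lt with rfl | hu
  · norm_num [sinhcDeriv_zero_zero]
  · have h := mul_sinhcDeriv_zero u
    have h1 := Real.add_one_le_exp (-(2 * u))
    rw [Real.sinh_eq] at h
    have h2 : Real.exp (-u) * Real.exp u = 1 := by rw [← Real.exp_add]; simp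
    have h3 : Real.exp (-u) * Real.exp (-u) = Real.exp (-(2 * u)) := by
      rw [← Real.exp_add]; ring_nf
    have h4 : u * (Real.exp (-u) * sinhcDeriv 0 (u ^ 2)) = (1 - Real.exp (-(2 * u))) / 2 := by
      rw [← h2, ← h3]
      linear_combination Real.exp (-u) * h
    have h5 := Real.exp_pos (-(2 * u))
    refine le_of_mul_le_mul_left ?_ hu
    calc _ = (1 + u) * (u * (Real.exp (-u) * sinhcDeriv 0 (u ^ 2))) := by ring
      _ ≤ _ := by rw [h4]; nlinarith

lemma le_sinhcDeriv_zero {u : ℝ} (hu : 0 ≤ u) :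
    1 / 2 ≤ (1 + u) * Real.exp (-u) * sinhcDeriv 0 (u ^ 2) := by
  rcases hu.eq_or_lt with rfl | hu
  · norm_num [sinhcDeriv_zero_zero]
  · have h := mul_sinhcDeriv_zero u
    have h1 := Real.add_one_le_exp (2 * u)
    rw [Real.sinh_eq] at h
    have h2 : Real.exp (-u) * Real.exp u = 1 := by rw [← Real.exp_add]; simp
    have h3 : Real.exp (-u) * Real.exp (-u) = Real.exp (-(2 * u)) := by
      rw [← Real.exp_add]; ring_nf
    have h4 : u * (Real.exp (-u) * sinhcDeriv 0 (u ^ 2)) = (1 - Real.exp (-(2 * u))) / 2 := by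
      rw [← h2, ← h3]
      linear_combination Real.exp (-u) * h
    have h5 : Real.exp (-(2 * u)) * Real.exp (2 * u) = 1 := by rw [← Real.exp_add]; simp
    have h6 := Real.exp_pos (-(2 * u))
    have h7 : Real.exp (-(2 * u)) * (1 + 2 * u) ≤ 1 := by nlinarith
    refine le_of_mul_le_mul_left ?_ hu
    calc u * (1 / 2) ≤ (1 + u) * (u * (Real.exp (-u) * sinhcDeriv 0 (u ^ 2))) := by
          rw [h4]; nlinarith
      _ = _ := by ring

lemma rpow_le_two_rpow_abs {R : ℝ} (h1 : 1 / 2 ≤ R) (h2 : R ≤ 2) (a : ℝ) : R ^ a ≤ 2 ^ |a| := by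
  have hR : 0 < R := by linarith
  rcases le_total 0 a with ha | ha
  · rw [abs_of_nonneg ha]
    exact Real.rpow_le_rpow hR.le h2 ha
  · rw [abs_of_nonpos ha, Real.rpow_neg (by norm_num), ← Real.inv_rpow (by norm_num)]
    exact Real.rpow_le_rpow_of_nonpos (by norm_num) (by linarith) ha

lemma rpow_neg_sinhcDeriv_zero_le {u : ℝ} (hu : 0 ≤ u) (a : ℝ) :
    sinhcDeriv 0 (u ^ 2) ^ (-a) ≤ 2 ^ |a| * ((1 + u) ^ a * Real.exp (-u * a)) := by
  have hG := sinhcDeriv_zero_pos (sq_nonneg u)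
  have hR := rpow_le_two_rpow_abs (le_sinhcDeriv_zero hu) (sinhcDeriv_zero_le hu) (-a)
  have hw : 0 < (1 + u) * Real.exp (-u) := by positivity
  have hwa : (1 + u) ^ a * Real.exp (-u * a) = ((1 + u) * Real.exp (-u)) ^ a := by
    rw [Real.mul_rpow (by positivity) (by positivity), Real.exp_mul]
  rw [abs_neg, Real.mul_rpow hw.le hG.le, Real.rpow_neg hw.le] at hR
  rw [hwa]
  have hwp := Real.rpow_pos_of_pos hw a
  rwa [inv_mul_le_iff₀ hwp, mul_comm] at hR

section Radial

variable {E : Type*} [NormedAddCommGroup E] [InnerProductSpace ℝ E]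

/-- The derivatives of a continuous linear map are bounded by `‖L‖ (1 + ‖x‖)`. -/
lemma ContinuousLinearMap.norm_iteratedFDeriv_le_mul_one_add {F : Type*} [NormedAddCommGroup F]
    [NormedSpace ℝ F] (L : E →L[ℝ] F) (k : ℕ) (x : E) :
    ‖iteratedFDeriv ℝ k L x‖ ≤ ‖L‖ * (1 + ‖x‖) := by
  match k with
  | 0 =>
    rw [norm_iteratedFDeriv_zero]
    nlinarith [L.le_opNorm x, norm_nonneg L]
  | 1 =>
    rw [norm_iteratedFDeriv_one, L.fderiv]
    nlinarith [mul_nonneg (norm_nonneg L) (norm_nonneg x)]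
  | k + 2 =>
    rw [← norm_iteratedFDeriv_fderiv, show fderiv ℝ L = fun _ => L from funext fun y => L.fderiv,
      iteratedFDeriv_succ_const]
    simp only [Pi.zero_apply, norm_zero]
    positivity

lemma hasFDerivAt_sinhcDeriv_norm_sq (m : ℕ) (x : E) :
    HasFDerivAt (fun y : E => sinhcDeriv m (‖y‖ ^ 2))
      (sinhcDeriv (m + 1) (‖x‖ ^ 2) • ((2 : ℝ) • innerSL ℝ : E →L[ℝ] E →L[ℝ] ℝ) x) x := by
  have h := (hasDerivAt_sinhcDeriv m (‖x‖ ^ 2)).comp_hasFDerivAt x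
    (hasStrictFDerivAt_norm_sq x).hasFDerivAt
  have e : (sinhcDeriv (m + 1) (‖x‖ ^ 2) • ((2 : ℝ) • innerSL ℝ : E →L[ℝ] E →L[ℝ] ℝ) x) =
      sinhcDeriv (m + 1) (‖x‖ ^ 2) • (2 • innerSL ℝ x) := by
    ext v
    simp
  rw [e]
  exact h

lemma contDiff_sinhcDeriv_norm_sq (N m : ℕ) :
    ContDiff ℝ N (fun y : E => sinhcDeriv m (‖y‖ ^ 2)) :=
  (contDiff_sinhcDeriv N m).comp (contDiff_norm_sq ℝ)

lemma exists_norm_iteratedFDeriv_sinhcDeriv_le (k : ℕ) : ∀ m : ℕ, ∃ C : ℝ, 0 < C ∧ ∀ x : E,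
    (1 + ‖x‖) ^ m * ‖iteratedFDeriv ℝ k (fun y : E => sinhcDeriv m (‖y‖ ^ 2)) x‖ ≤
      C * sinhcDeriv 0 (‖x‖ ^ 2) := by
  induction k using Nat.strong_induction_on with
  | _ k ih =>
  intro m
  rcases k with _ | k
  · refine ⟨4 ^ m, by positivity, fun x => ?_⟩
    rw [norm_iteratedFDeriv_zero, Real.norm_of_nonneg (sinhcDeriv_nonneg m (sq_nonneg _))]
    exact one_add_pow_mul_sinhcDeriv_le m (norm_nonneg x)
  · have ih' : ∀ i, ∃ C : ℝ, 0 < C ∧ (i < k + 1 → ∀ x : E,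
        (1 + ‖x‖) ^ (m + 1) * ‖iteratedFDeriv ℝ i (fun y : E => sinhcDeriv (m + 1) (‖y‖ ^ 2)) x‖ ≤
          C * sinhcDeriv 0 (‖x‖ ^ 2)) := by
      intro i
      by_cases hi : i < k + 1
      · obtain ⟨C, hC, h⟩ := ih i hi (m + 1)
        exact ⟨C, hC, fun _ => h⟩
      · exact ⟨1, one_pos, fun h => absurd h hi⟩
    choose C hC h using ih'
    set L : E →L[ℝ] E →L[ℝ] ℝ := (2 : ℝ) • innerSL ℝ with hL
    refine ⟨1 + ∑ i ∈ Finset.range (k + 1), (k.choose i : ℝ) * (C i * ‖L‖), ?_, fun x => ?_⟩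
    · have : 0 ≤ ∑ i ∈ Finset.range (k + 1), (k.choose i : ℝ) * (C i * ‖L‖) :=
        Finset.sum_nonneg fun i _ => by have := hC i; positivity
      linarith
    have hG := sinhcDeriv_zero_pos (sq_nonneg ‖x‖)
    rw [← norm_iteratedFDeriv_fderiv,
      show fderiv ℝ (fun y : E => sinhcDeriv m (‖y‖ ^ 2)) =
        fun y => sinhcDeriv (m + 1) (‖y‖ ^ 2) • L y from
        funext fun y => (hasFDerivAt_sinhcDeriv_norm_sq m y).fderiv]
    have hle := norm_iteratedFDeriv_smul_le (𝕜 := ℝ) (contDiff_sinhcDeriv_norm_sq (E := E) k (m + 1))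
      (L.contDiff (n := k)) x le_rfl
    calc _ ≤ (1 + ‖x‖) ^ m * _ := mul_le_mul_of_nonneg_left hle (by positivity)
      _ ≤ (∑ i ∈ Finset.range (k + 1), (k.choose i : ℝ) * (C i * ‖L‖)) *
          sinhcDeriv 0 (‖x‖ ^ 2) := by
        rw [Finset.mul_sum, Finset.sum_mul]
        refine Finset.sum_le_sum fun i hi => ?_
        have h1 := h i (Finset.mem_range.1 hi) x
        have h2 := L.norm_iteratedFDeriv_le_mul_one_add (k - i) x
        calc _ ≤ (1 + ‖x‖) ^ m * ((k.choose i : ℝ) *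
              ‖iteratedFDeriv ℝ i (fun y : E => sinhcDeriv (m + 1) (‖y‖ ^ 2)) x‖ *
              (‖L‖ * (1 + ‖x‖))) := by gcongr
          _ = (k.choose i : ℝ) * ‖L‖ * ((1 + ‖x‖) ^ (m + 1) *
              ‖iteratedFDeriv ℝ i (fun y : E => sinhcDeriv (m + 1) (‖y‖ ^ 2)) x‖) := by ring
          _ ≤ (k.choose i : ℝ) * ‖L‖ * (C i * sinhcDeriv 0 (‖x‖ ^ 2)) := by gcongr
          _ = _ := by ring
      _ ≤ _ := by nlinarith

lemma contDiff_ofReal_cpow {G : E → ℝ} (hpos : ∀ x, 0 < G x) {N : ℕ} (hsmooth : ContDiff ℝ N G)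
    (γ : ℂ) : ContDiff ℝ N (fun y => (G y : ℂ) ^ γ) := by
  have e : (fun y => (G y : ℂ) ^ γ) = fun y => Complex.exp (Complex.ofRealCLM (Real.log (G y)) * γ) := by
    funext y
    rw [Complex.cpow_def_of_ne_zero (by exact_mod_cast (hpos y).ne'), ← Complex.ofReal_log (hpos y).le]
    rfl
  rw [e]
  have h1 := hsmooth.log fun x => (hpos x).ne'
  exact ((Complex.ofRealCLM.contDiff.comp h1).mul contDiff_const).cexp

/-- If every derivative of a positive function `G` is dominated by `G`, then every derivative of
`G ^ γ` is dominated by `G ^ Re γ`. -/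
lemma exists_norm_iteratedFDeriv_cpow_le {G : E → ℝ} (hpos : ∀ x, 0 < G x)
    (hsmooth : ∀ N : ℕ, ContDiff ℝ N G)
    (hbound : ∀ k, ∃ C : ℝ, 0 < C ∧ ∀ x, ‖iteratedFDeriv ℝ k G x‖ ≤ C * G x) (k : ℕ) :
    ∀ γ : ℂ, ∃ C : ℝ, 0 < C ∧ ∀ x : E,
      ‖iteratedFDeriv ℝ k (fun y => (G y : ℂ) ^ γ) x‖ ≤ C * G x ^ γ.re := by
  induction k using Nat.strong_induction_on with
  | _ k ih =>
  intro γ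
  rcases k with _ | k
  · refine ⟨1, one_pos, fun x => ?_⟩
    rw [norm_iteratedFDeriv_zero, Complex.norm_cpow_eq_rpow_re_of_pos (hpos x), one_mul]
  · have ih' : ∀ i, ∃ C : ℝ, 0 < C ∧ (i < k + 1 → ∀ x : E,
        ‖iteratedFDeriv ℝ i (fun y => (G y : ℂ) ^ (γ - 1)) x‖ ≤ C * G x ^ (γ - 1).re) := by
      intro i
      by_cases hi : i < k + 1
      · obtain ⟨C, hC, h⟩ := ih i hi (γ - 1)
        exact ⟨C, hC, fun _ => h⟩
      · exact ⟨1, one_pos, fun h => absurd h hi⟩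
    choose C hC h using ih'
    choose D hD hd using hbound
    refine ⟨1 + ∑ i ∈ Finset.range (k + 1), (k.choose i : ℝ) * D (i + 1) * (‖γ‖ * C (k - i)),
      ?_, fun x => ?_⟩
    · have : 0 ≤ ∑ i ∈ Finset.range (k + 1), (k.choose i : ℝ) * D (i + 1) * (‖γ‖ * C (k - i)) :=
        Finset.sum_nonneg fun i _ => by have := hC (k - i); have := hD (i + 1); positivity
      linarith
    have hderiv : fderiv ℝ (fun y => (G y : ℂ) ^ γ) = fun y =>
        ContinuousLinearMap.smulRightL ℝ E ℂ (fderiv ℝ G y) (γ • (G y : ℂ) ^ (γ - 1)) := by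
      funext y
      have hG : HasFDerivAt G (fderiv ℝ G y) y :=
        ((hsmooth 1).differentiable (by simp) y).hasFDerivAt
      have hp : HasDerivAt (fun r : ℝ => (r : ℂ) ^ γ) (γ * (G y : ℂ) ^ (γ - 1)) (G y) :=
        (Complex.hasStrictDerivAt_cpow_const
          (Complex.ofReal_mem_slitPlane.2 (hpos y))).hasDerivAt.comp_ofReal
      refine (hp.hasFDerivAt.comp y hG).fderiv.trans ?_
      ext v
      simp
    have hGk : ContDiff ℝ k (fderiv ℝ G) :=
      (hsmooth (k + 1)).fderiv_right (by push_cast; exact le_rfl)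
    have hQ : ∀ N : ℕ, ContDiff ℝ N fun y => (G y : ℂ) ^ (γ - 1) :=
      fun N => contDiff_ofReal_cpow hpos (hsmooth N) _
    rw [← norm_iteratedFDeriv_fderiv, hderiv]
    have hle := (ContinuousLinearMap.smulRightL ℝ E ℂ).norm_iteratedFDeriv_le_of_bilinear_of_le_one
      hGk ((hQ k).const_smul γ) x le_rfl ContinuousLinearMap.norm_smulRightL_le
    have hGx := hpos x
    have hGγ : 0 < G x ^ γ.re := Real.rpow_pos_of_pos hGx _
    calc _ ≤ _ := hle
      _ ≤ (∑ i ∈ Finset.range (k + 1), (k.choose i : ℝ) * D (i + 1) * (‖γ‖ * C (k - i))) *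
          G x ^ γ.re := by
        rw [Finset.sum_mul]
        refine Finset.sum_le_sum fun i hi => ?_
        have hi' : k - i < k + 1 := by omega
        have h1 := h (k - i) hi' x
        have h2 := hd (i + 1) x
        rw [norm_iteratedFDeriv_fderiv,
          iteratedFDeriv_const_smul_apply' (hQ (k - i)).contDiffAt, norm_smul]
        have hD' := hD (i + 1)
        calc _ ≤ (k.choose i : ℝ) * (D (i + 1) * G x) *
              (‖γ‖ * (C (k - i) * G x ^ (γ - 1).re)) := by gcongr
          _ = (k.choose i : ℝ) * D (i + 1) * (‖γ‖ * C (k - i)) *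
              (G x ^ (γ - 1).re * G x) := by ring
          _ = _ := by
            rw [Complex.sub_re, Complex.one_re, Real.rpow_sub_one hGx.ne',
              div_mul_cancel₀ _ hGx.ne']
      _ ≤ _ := by nlinarith

end Radial

theorem stmt14 (d k : ℕ) (γ : ℂ) :
    ∃ C : ℝ, 0 < C ∧ ∀ t : ℝ, 0 < t → ∀ μ : EuclideanSpace ℝ (Fin d),
      ‖iteratedFDeriv ℝ k
          (fun ν : EuclideanSpace ℝ (Fin d) => ((Sfun (t * ‖ν‖) : ℂ)) ^ γ) μ‖ ≤
        C * t ^ k * (1 + t * ‖μ‖) ^ γ.re * Real.exp (-(t * ‖μ‖) * γ.re) := by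
  set G : EuclideanSpace ℝ (Fin d) → ℝ := fun y => sinhcDeriv 0 (‖y‖ ^ 2) with hGdef
  have hpos : ∀ x, 0 < G x := fun x => sinhcDeriv_zero_pos (sq_nonneg _)
  have hsmooth : ∀ N : ℕ, ContDiff ℝ N G := fun N => contDiff_sinhcDeriv_norm_sq N 0
  obtain ⟨C, hC, h⟩ := exists_norm_iteratedFDeriv_cpow_le hpos hsmooth
    (fun k => by simpa using exists_norm_iteratedFDeriv_sinhcDeriv_le k 0) k (-γ)
  refine ⟨C * 2 ^ |γ.re|, by positivity, fun t ht μ => ?_⟩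
  have e : (fun ν : EuclideanSpace ℝ (Fin d) => ((Sfun (t * ‖ν‖) : ℂ)) ^ γ) =
      fun ν => (fun y => (G y : ℂ) ^ (-γ)) (t • ν) := by
    funext ν
    have hn : ‖t • ν‖ = t * ‖ν‖ := by rw [norm_smul, Real.norm_of_nonneg ht.le]
    have hp : 0 < sinhcDeriv 0 ((t * ‖ν‖) ^ 2) := sinhcDeriv_zero_pos (sq_nonneg _)
    simp only [hGdef, hn, Sfun_eq_inv]
    rw [Complex.cpow_neg, Complex.ofReal_inv, Complex.inv_cpow]
    rw [Complex.arg_ofReal_of_nonneg hp.le]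
    exact Real.pi_pos.ne
  have hn : ‖t • μ‖ = t * ‖μ‖ := by rw [norm_smul, Real.norm_of_nonneg ht.le]
  rw [e, iteratedFDeriv_comp_const_smul t (contDiff_ofReal_cpow hpos (hsmooth k) (-γ)), norm_smul,
    norm_pow, Real.norm_of_nonneg ht.le]
  have hu : 0 ≤ t * ‖μ‖ := by positivity
  have h1 := h (t • μ)
  have h2 := rpow_neg_sinhcDeriv_zero_le hu γ.re
  rw [Complex.neg_re] at h1
  simp only [hGdef, hn] at h1
  calc _ ≤ t ^ k * (C * (2 ^ |γ.re| * ((1 + t * ‖μ‖) ^ γ.re *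
        Real.exp (-(t * ‖μ‖) * γ.re)))) := by
        refine mul_le_mul_of_nonneg_left (h1.trans ?_) (by positivity)
        exact mul_le_mul_of_nonneg_left h2 hC.le
    _ = _ := by ring
end

section
/- Let $S > -1$ and $c \in (0,1)$, $\kappa > 0$. Define, for $\lambda > 0$ and $\mu \in \mathbb{R}^d$, $I(\lambda,\mu) = \int_0^\infty \left(\frac{t|\mu|}{\sinh(t|\mu|)}\right)^{1+S} e^{-\mathfrak{T}(t|\mu|)/t}\, e^{-t\lambda}\, t^{-S}\,\frac{dt}{t}$ where $\mathfrak{T}(u) = u\coth u$. Then for $\lambda + (S+1)|\mu| \geq \kappa|\mu|$: $|I(\lambda,\mu)| \lesssim_{S,c,\kappa} (\lambda + (S+1)|\mu|)^{S/2}\, K_{S}\!\left(2c\sqrt{\lambda + (S+1)|\mu|}\right)$, where $K_S$ is the modified Bessel function of the second kind; in particular $|I(\lambda,\mu)| \lesssim (\lambda+(S+1)|\mu|)^{\min\{S,0\}\cdot\mathbf{1}_{S\neq 0}}\log(e + 1/(\lambda+(S+1)|\mu|))^{\mathbf{1}_{S=0}}\, e^{-2c\sqrt{\lambda+(S+1)|\mu|}}$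 up to constants. -/
open MeasureTheory Real

/-- The modified Bessel function of the second kind. -/
noncomputable def besselK (ν t : ℝ) : ℝ :=
  (1 / 2) * (t / 2) ^ ν *
    ∫ s in Set.Ioi (0 : ℝ), Real.exp (-s - t ^ 2 / (4 * s)) * s ^ (-ν - 1)

open Set

theorem sinh_le_mul_cosh {u : ℝ} (hu : 0 < u) : sinh u ≤ u * cosh u := by
  obtain ⟨x, ⟨hx0, hxu⟩, hx⟩ := exists_hasDerivAt_eq_slope sinh cosh hu
    continuous_sinh.continuousOn fun y _ => hasDerivAt_sinh y
  have hcosh : cosh x ≤ cosh u := by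
    rw [cosh_le_cosh, abs_of_pos hx0, abs_of_pos hu]
    exact hxu.le
  rw [sinh_zero, sub_zero, sub_zero, eq_div_iff hu.ne'] at hx
  nlinarith

theorem one_le_Tfun {u : ℝ} (hu : 0 ≤ u) : 1 ≤ Tfun u := by
  unfold Tfun
  split_ifs with h
  · exact le_rfl
  · have hu' : 0 < u := lt_of_le_of_ne hu (Ne.symm h)
    rw [tanh_eq_sinh_div_cosh, div_div_eq_mul_div, one_le_div (sinh_pos_iff.2 hu')]
    exact sinh_le_mul_cosh hu'

theorem Sfun_nonneg {u : ℝ} (hu : 0 ≤ u) : 0 ≤ Sfun u := by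
  unfold Sfun
  split_ifs
  · exact zero_le_one
  · exact div_nonneg hu (sinh_nonneg_iff.2 hu)

theorem Sfun_le {c u : ℝ} (hc : c ∈ Ioo (0 : ℝ) 1) (hu : 0 ≤ u) :
    Sfun u ≤ 2 / (1 - c) * exp (-(c * u)) := by
  have hc1 : 0 < 1 - c := sub_pos.2 hc.2
  unfold Sfun
  split_ifs with h
  · subst h
    rw [mul_zero, neg_zero, exp_zero, mul_one, one_le_div hc1]
    linarith [hc.1]
  · have hu' : 0 < u := lt_of_le_of_ne hu (Ne.symm h)
    rw [div_le_iff₀ (sinh_pos_iff.2 hu'), sinh_eq]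
    have e1 : exp (-(c * u)) * exp u = exp ((1 - c) * u) := by
      rw [← exp_add]; ring_nf
    have e2 : exp (-(c * u)) * exp (-u) ≤ 1 := by
      rw [← exp_add, exp_le_one_iff]
      nlinarith [hc.1]
    have e3 := add_one_le_exp ((1 - c) * u)
    calc u = 1 / (1 - c) * ((1 - c) * u + 1 - 1) := by field_simp; ring
      _ ≤ 1 / (1 - c) * (exp (-(c * u)) * exp u - exp (-(c * u)) * exp (-u)) := by
        gcongr
        rw [e1]
        exact e3
      _ = _ := by ring

theorem integrableOn_exp_neg_mul_add_div_mul_rpow {a b : ℝ} (ha : 0 < a) (hb : 0 < b) (p : ℝ) :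
    IntegrableOn (fun t : ℝ => exp (-(a * t + b / t)) * t ^ p) (Ioi 0) := by
  obtain ⟨n, hn⟩ := exists_nat_gt (-1 - p)
  have key : IntegrableOn (fun t : ℝ => n.factorial / b ^ n * (t ^ (p + n) * exp (-a * t ^ (1 : ℝ))))
      (Ioi 0) :=
    (integrableOn_rpow_mul_exp_neg_mul_rpow (by linarith) one_pos ha).const_mul _
  refine key.mono' (by fun_prop) ((ae_restrict_iff' measurableSet_Ioi).2 (.of_forall fun t ht => ?_))
  have ht : 0 < t := ht
  rw [norm_of_nonneg (by positivity), neg_add, exp_add, rpow_one, rpow_add ht, rpow_natCast]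
  have h1 : exp (-(b / t)) ≤ n.factorial / b ^ n * t ^ n := by
    have h := pow_div_factorial_le_exp (b / t) (by positivity) n
    rw [exp_neg]
    refine (inv_anti₀ (by positivity) h).trans_eq ?_
    rw [div_pow]
    field_simp
  calc exp (-(a * t)) * exp (-(b / t)) * t ^ p
      ≤ exp (-(a * t)) * (n.factorial / b ^ n * t ^ n) * t ^ p := by gcongr
    _ = _ := by rw [neg_mul]; ring

theorem rpow_half_mul_besselK {c L : ℝ} (hc : 0 < c) (hL : 0 < L) (S : ℝ) :
    L ^ (S / 2) * besselK S (2 * c * √L) =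
      1 / 2 * ∫ t in Ioi (0 : ℝ), exp (-(c * L * t + c / t)) * t ^ (-S - 1) := by
  have hcL : 0 < c * L := mul_pos hc hL
  have hsub := integral_comp_mul_left_Ioi
    (fun s : ℝ => exp (-s - (2 * c * √L) ^ 2 / (4 * s)) * s ^ (-S - 1)) 0 hcL
  rw [mul_zero, smul_eq_mul, eq_inv_mul_iff_mul_eq₀ hcL.ne'] at hsub
  have hcongr : ∫ t in Ioi (0 : ℝ), exp (-(c * L * t) - (2 * c * √L) ^ 2 / (4 * (c * L * t))) *
      (c * L * t) ^ (-S - 1) =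
      (c * L) ^ (-S - 1) * ∫ t in Ioi (0 : ℝ), exp (-(c * L * t + c / t)) * t ^ (-S - 1) := by
    rw [← integral_const_mul]
    refine setIntegral_congr_fun measurableSet_Ioi fun t ht => ?_
    have ht : 0 < t := ht
    have he : (2 * c * √L) ^ 2 / (4 * (c * L * t)) = c / t := by
      rw [mul_pow, sq_sqrt hL.le]
      field_simp
      ring
    simp only [he]
    rw [mul_rpow hcL.le ht.le, neg_add, sub_eq_add_neg]
    ring
  rw [hcongr] at hsub
  unfold besselK
  rw [← hsub]
  have hpow : L ^ (S / 2) * (2 * c * √L / 2) ^ S * (c * L * (c * L) ^ (-S - 1)) = 1 := by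
    have h1 : 2 * c * √L / 2 = c * L ^ (1 / 2 : ℝ) := by rw [sqrt_eq_rpow]; ring
    have h2 : c * L * (c * L) ^ (-S - 1) = (c * L) ^ (-S) := by
      conv_rhs => rw [show -S = 1 + (-S - 1) by ring, rpow_add hcL, rpow_one]
    rw [h1, h2, mul_rpow hc.le (by positivity), ← rpow_mul hL.le, mul_rpow hc.le hL.le,
      show 1 / 2 * S = S / 2 by ring]
    have h3 : c ^ S * c ^ (-S) = 1 := by rw [← rpow_add hc, add_neg_cancel, rpow_zero]
    have h4 : L ^ (S / 2) * L ^ (S / 2) * L ^ (-S) = 1 := by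
      rw [← rpow_add hL, ← rpow_add hL, add_halves, add_neg_cancel, rpow_zero]
    linear_combination h4 + L ^ (S / 2) * L ^ (S / 2) * L ^ (-S) * h3
  linear_combination (1 / 2 * ∫ t in Ioi (0 : ℝ), exp (-(c * L * t + c / t)) * t ^ (-S - 1)) * hpow

theorem abs_integral_Sfun_Tfun_le {S c l m : ℝ} (hS : -1 < S) (hc : c ∈ Ioo (0 : ℝ) 1)
    (hl : 0 < l) (hm : 0 ≤ m) :
    |∫ t in Ioi (0 : ℝ), Sfun (t * m) ^ (1 + S) * exp (-Tfun (t * m) / t) *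
        exp (-(t * l)) * t ^ (-S) / t| ≤
      (2 / (1 - c)) ^ (1 + S) *
        ∫ t in Ioi (0 : ℝ), exp (-(c * (l + (S + 1) * m) * t + c / t)) * t ^ (-S - 1) := by
  have hc0 := hc.1
  have hc1 : 0 < 1 - c := sub_pos.2 hc.2
  have hS1 : 0 < S + 1 := by linarith
  have hint := (integrableOn_exp_neg_mul_add_div_mul_rpow
    (a := c * (l + (S + 1) * m)) (by positivity) hc0 (-S - 1)).const_mul ((2 / (1 - c)) ^ (1 + S))
  rw [← integral_const_mul, ← norm_eq_abs]
  refine norm_integral_le_of_norm_le hint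
    ((ae_restrict_iff' measurableSet_Ioi).2 (.of_forall fun t ht => ?_))
  have ht : 0 < t := ht
  have htm : 0 ≤ t * m := by positivity
  have hs0 := Sfun_nonneg htm
  rw [norm_of_nonneg (by positivity)]
  have hT : exp (-Tfun (t * m) / t) ≤ exp (-(c / t)) := by
    rw [exp_le_exp, neg_div, neg_le_neg_iff]
    gcongr
    exact hc.2.le.trans (one_le_Tfun htm)
  have hSp : Sfun (t * m) ^ (1 + S) ≤
      (2 / (1 - c)) ^ (1 + S) * exp (-(c * (S + 1) * m * t)) := by
    calc Sfun (t * m) ^ (1 + S) ≤ (2 / (1 - c) * exp (-(c * (t * m)))) ^ (1 + S) :=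
          rpow_le_rpow hs0 (Sfun_le hc htm) (by linarith)
      _ = _ := by
        rw [mul_rpow (by positivity) (by positivity), ← exp_mul]
        ring_nf
  have hexp : exp (-(t * l)) ≤ exp (-(c * l * t)) := by
    rw [exp_le_exp, neg_le_neg_iff]
    have := mul_le_mul_of_nonneg_right hc.2.le (mul_pos hl ht).le
    linarith
  calc Sfun (t * m) ^ (1 + S) * exp (-Tfun (t * m) / t) * exp (-(t * l)) * t ^ (-S) / t
      ≤ ((2 / (1 - c)) ^ (1 + S) * exp (-(c * (S + 1) * m * t))) * exp (-(c / t)) *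
          exp (-(c * l * t)) * t ^ (-S) / t := by gcongr
    _ = (2 / (1 - c)) ^ (1 + S) *
          (exp (-(c * (S + 1) * m * t)) * exp (-(c / t)) * exp (-(c * l * t))) *
            (t ^ (-S) / t) := by ring
    _ = _ := by
      rw [← exp_add, ← exp_add, rpow_sub_one ht.ne', mul_assoc]
      ring_nf

theorem integral_exp_neg_mul_add_div_mul_rpow_le {a b c L : ℝ} (hc : 0 < c) (hcb : c < b)
    (hL : 0 < L) (ha : a = b - c) (p : ℝ) :
    ∫ t in Ioi (0 : ℝ), exp (-(b * L * t + b / t)) * t ^ p ≤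
      exp (-2 * c * √L) * ∫ t in Ioi (0 : ℝ), exp (-(a * L * t + a / t)) * t ^ p := by
  have ha0 : 0 < a := by linarith
  have hb0 : 0 < b := by linarith
  rw [← integral_const_mul]
  refine setIntegral_mono_on
    (integrableOn_exp_neg_mul_add_div_mul_rpow (mul_pos hb0 hL) hb0 p)
    ((integrableOn_exp_neg_mul_add_div_mul_rpow (mul_pos ha0 hL) ha0 p).const_mul _)
    measurableSet_Ioi fun t ht => ?_
  have ht : 0 < t := ht
  rw [← mul_assoc, ← exp_add]
  gcongr
  have amgm : 2 * √L ≤ L * t + 1 / t := by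
    have h : L * t + 1 / t - 2 * √L = (√L * t - 1) ^ 2 / t := by
      field_simp
      linear_combination (-t ^ 2) * sq_sqrt hL.le
    have := div_nonneg (sq_nonneg (√L * t - 1)) ht.le
    linarith
  have hexpand : b * L * t + b / t = a * L * t + a / t + c * (L * t + 1 / t) := by
    rw [ha]; ring
  nlinarith

theorem integral_exp_neg_mul_add_div_mul_rpow_le_of_pos {S a : ℝ} (hS : 0 < S) (ha : 0 < a) :
    ∃ C : ℝ, 0 < C ∧ ∀ L : ℝ, 0 < L →
      ∫ t in Ioi (0 : ℝ), exp (-(a * L * t + a / t)) * t ^ (-S - 1) ≤ C := by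
  have hint : IntegrableOn (fun t : ℝ => exp (-(a / t)) * t ^ (-S - 1)) (Ioi 0) := by
    have h := (integrableOn_Ioi_comp_rpow_iff' (fun x : ℝ => x ^ (S - 1) * exp (-a * x ^ (1 : ℝ)))
      (p := -1) (by norm_num)).2
      (integrableOn_rpow_mul_exp_neg_mul_rpow (by linarith) one_pos ha)
    refine h.congr_fun (fun t ht => ?_) measurableSet_Ioi
    have ht : 0 < t := ht
    simp only [smul_eq_mul]
    rw [rpow_one, ← rpow_mul ht.le, ← mul_assoc, ← rpow_add ht, rpow_neg_one, mul_comm]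
    congr 2 <;> ring
  refine ⟨1 + ∫ t in Ioi (0 : ℝ), exp (-(a / t)) * t ^ (-S - 1), ?_, fun L hL => ?_⟩
  · have : 0 ≤ ∫ t in Ioi (0 : ℝ), exp (-(a / t)) * t ^ (-S - 1) :=
      setIntegral_nonneg measurableSet_Ioi fun t ht =>
        mul_nonneg (exp_pos _).le (rpow_nonneg (mem_Ioi.1 ht).le _)
    linarith
  · refine (setIntegral_mono_on
      (integrableOn_exp_neg_mul_add_div_mul_rpow (mul_pos ha hL) ha _) hint
      measurableSet_Ioi fun t ht => ?_).trans (by linarith)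
    have ht : 0 < t := ht
    gcongr
    have : 0 < a * L * t := by positivity
    linarith

theorem integral_exp_neg_mul_add_div_mul_rpow_le_of_neg {S a L : ℝ} (hS : S < 0) (ha : 0 < a)
    (hL : 0 < L) :
    ∫ t in Ioi (0 : ℝ), exp (-(a * L * t + a / t)) * t ^ (-S - 1) ≤
      a ^ S * Gamma (-S) * L ^ S := by
  have haL : 0 < a * L := mul_pos ha hL
  have hint : IntegrableOn (fun t : ℝ => t ^ (-S - 1) * exp (-(a * L * t))) (Ioi 0) := by
    have h := integrableOn_rpow_mul_exp_neg_mul_rpow (s := -S - 1) (by linarith) one_pos haL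
    simpa only [rpow_one, neg_mul] using h
  calc _ ≤ ∫ t in Ioi (0 : ℝ), t ^ (-S - 1) * exp (-(a * L * t)) := by
        refine setIntegral_mono_on
          (integrableOn_exp_neg_mul_add_div_mul_rpow haL ha _) hint measurableSet_Ioi
          fun t ht => ?_
        have ht : 0 < t := ht
        rw [mul_comm]
        gcongr
        have : 0 < a / t := by positivity
        linarith
    _ = _ := by
      rw [integral_rpow_mul_exp_neg_mul_Ioi (by linarith) haL, one_div, inv_rpow haL.le,
        ← rpow_neg haL.le, neg_neg, mul_rpow ha.le hL.le]
      ring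

theorem integral_exp_neg_mul_add_div_mul_rpow_neg_one_le {a L : ℝ} (ha : 0 < a) (hL : 0 < L) :
    ∫ t in Ioi (0 : ℝ), exp (-(a * L * t + a / t)) * t ^ (-1 : ℝ) ≤
      (2 / a + 1) * log (exp 1 + 1 / L) := by
  have haL : 0 < a * L := mul_pos ha hL
  set M := exp 1 + 1 / L with hM
  have hL' : 0 < 1 / L := by positivity
  have hM1 : 1 ≤ M := by linarith [one_le_exp (zero_le_one' ℝ)]
  have hM0 : 0 < M := by linarith
  have hlog : 1 ≤ log M := by
    rw [le_log_iff_exp_le hM0]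
    linarith
  have hLM : 1 ≤ L * M := by
    have : L * M = L * exp 1 + 1 := by rw [hM]; field_simp
    rw [this]
    have : 0 < L * exp 1 := by positivity
    linarith
  set F : ℝ → ℝ := fun t => exp (-(a * L * t + a / t)) * t ^ (-1 : ℝ) with hF
  have hint : IntegrableOn F (Ioi 0) := integrableOn_exp_neg_mul_add_div_mul_rpow haL ha _
  have hintM : IntegrableOn F (Ioi M) := hint.mono_set (Ioi_subset_Ioi hM0.le)
  have hint01 : IntegrableOn F (Ioc 0 1) := hint.mono_set Ioc_subset_Ioi_self
  have hint1M : IntegrableOn F (Ioc 1 M) :=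
    hint.mono_set fun t ht => lt_trans one_pos ht.1
  have hsplit : ∫ t in Ioi (0 : ℝ), F t =
      (∫ t in Ioc 0 1, F t) + ((∫ t in Ioc 1 M, F t) + ∫ t in Ioi M, F t) := by
    rw [← setIntegral_union (Ioc_disjoint_Ioi le_rfl) measurableSet_Ioi hint1M hintM,
      Ioc_union_Ioi_eq_Ioi hM1,
      ← setIntegral_union (Ioc_disjoint_Ioi le_rfl) measurableSet_Ioi hint01
        (hint.mono_set (Ioi_subset_Ioi zero_le_one)), Ioc_union_Ioi_eq_Ioi zero_le_one]
  have hnear : ∫ t in Ioc 0 1, F t ≤ 1 / a := by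
    calc ∫ t in Ioc 0 1, F t ≤ ∫ _ in Ioc (0 : ℝ) 1, 1 / a := by
          refine setIntegral_mono_on hint01 (integrableOn_const (by simp)) measurableSet_Ioc
            fun t ht => ?_
          have ht : 0 < t := ht.1
          have h1 : a / t ≤ exp (a / t) := by linarith [add_one_le_exp (a / t)]
          have h2 : exp (-(a * L * t + a / t)) ≤ t / a := by
            calc exp (-(a * L * t + a / t)) ≤ exp (-(a / t)) := by
                  rw [exp_le_exp]
                  have : 0 < a * L * t := by positivity
                  linarith
              _ ≤ (a / t)⁻¹ := by
                  rw [exp_neg]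
                  exact inv_anti₀ (by positivity) h1
              _ = t / a := inv_div _ _
          calc F t ≤ t / a * t ^ (-1 : ℝ) := by
                simp only [hF]
                gcongr
            _ = 1 / a := by
                rw [rpow_neg_one]
                field_simp
      _ = 1 / a := by simp
  have hmid : ∫ t in Ioc 1 M, F t ≤ log M := by
    calc ∫ t in Ioc 1 M, F t ≤ ∫ t in Ioc 1 M, 1 / t := by
          refine setIntegral_mono_on hint1M ?_ measurableSet_Ioc fun t ht => ?_
          · rw [← intervalIntegrable_iff_integrableOn_Ioc_of_le hM1]
            refine intervalIntegral.intervalIntegrable_one_div (fun x hx => ?_) continuousOn_id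
            rw [uIcc_of_le hM1] at hx
            exact (lt_of_lt_of_le one_pos hx.1).ne'
          · have ht : 0 < t := lt_trans one_pos ht.1
            simp only [hF]
            rw [rpow_neg_one, one_div]
            refine mul_le_of_le_one_left (by positivity) (exp_le_one_iff.2 ?_)
            have : 0 < a * L * t + a / t := by positivity
            linarith
      _ = log M := by
        rw [← intervalIntegral.integral_of_le hM1, integral_one_div_of_pos one_pos hM0, div_one]
  have hfar : ∫ t in Ioi M, F t ≤ 1 / a := by
    have hneg : -(a * L) < 0 := neg_lt_zero.2 haL
    calc ∫ t in Ioi M, F t ≤ ∫ t in Ioi M, M⁻¹ * exp (-(a * L) * t) := by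
          refine setIntegral_mono_on hintM ((integrableOn_exp_mul_Ioi hneg M).const_mul _)
            measurableSet_Ioi fun t ht => ?_
          have htM : M < t := ht
          have ht : 0 < t := hM0.trans htM
          simp only [hF]
          rw [rpow_neg_one, mul_comm]
          gcongr
          have : 0 < a / t := by positivity
          linarith
      _ = exp (-(a * L) * M) / (a * (L * M)) := by
        rw [integral_const_mul, integral_exp_mul_Ioi hneg]
        field_simp
      _ ≤ 1 / a := by
        have h1 : exp (-(a * L) * M) ≤ 1 := by
          rw [exp_le_one_iff]
          have : 0 < a * L * M := by positivity
          linarith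
        gcongr
        exact le_mul_of_one_le_right ha.le hLM
  rw [hsplit]
  have : 2 / a ≤ 2 / a * log M := le_mul_of_one_le_right (by positivity) hlog
  have h2 : 2 / a = 1 / a + 1 / a := by ring
  linarith

theorem exists_integral_exp_neg_mul_add_div_mul_rpow_le (S : ℝ) {a : ℝ} (ha : 0 < a) :
    ∃ C : ℝ, 0 < C ∧ ∀ L : ℝ, 0 < L →
      ∫ t in Ioi (0 : ℝ), exp (-(a * L * t + a / t)) * t ^ (-S - 1) ≤
        C * if S = 0 then log (exp 1 + 1 / L) else L ^ (min S 0) := by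
  rcases lt_trichotomy S 0 with hS | hS | hS
  · refine ⟨a ^ S * Gamma (-S), mul_pos (rpow_pos_of_pos ha _) (Gamma_pos_of_pos (by linarith)),
      fun L hL => ?_⟩
    rw [if_neg hS.ne, min_eq_left hS.le]
    exact integral_exp_neg_mul_add_div_mul_rpow_le_of_neg hS ha hL
  · subst hS
    refine ⟨2 / a + 1, by positivity, fun L hL => ?_⟩
    rw [if_pos rfl, neg_zero, zero_sub]
    exact integral_exp_neg_mul_add_div_mul_rpow_neg_one_le ha hL
  · obtain ⟨C, hC, h⟩ := integral_exp_neg_mul_add_div_mul_rpow_le_of_pos hS ha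
    refine ⟨C, hC, fun L hL => ?_⟩
    rw [if_neg hS.ne', min_eq_right hS.le, rpow_zero, mul_one]
    exact h L hL

theorem stmt15 (S c κ : ℝ) (hS : -1 < S) (hc : c ∈ Set.Ioo (0:ℝ) 1) (hκ : 0 < κ)
    (d : ℕ) :
    ∃ C : ℝ, 0 < C ∧ ∀ l : ℝ, 0 < l → ∀ μ : EuclideanSpace ℝ (Fin d),
      κ * ‖μ‖ ≤ l + (S + 1) * ‖μ‖ →
      |∫ t in Set.Ioi (0:ℝ),
          Sfun (t * ‖μ‖) ^ (1 + S) * Real.exp (-Tfun (t * ‖μ‖) / t) *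
            Real.exp (-(t * l)) * t ^ (-S) / t| ≤
          C * (l + (S + 1) * ‖μ‖) ^ (S / 2) *
            besselK S (2 * c * Real.sqrt (l + (S + 1) * ‖μ‖)) ∧
      |∫ t in Set.Ioi (0:ℝ),
          Sfun (t * ‖μ‖) ^ (1 + S) * Real.exp (-Tfun (t * ‖μ‖) / t) *
            Real.exp (-(t * l)) * t ^ (-S) / t| ≤
          C * (if S = 0 then Real.log (Real.exp 1 + 1 / (l + (S + 1) * ‖μ‖))
              else (l + (S + 1) * ‖μ‖) ^ (min S 0)) *
            Real.exp (-2 * c * Real.sqrt (l + (S + 1) * ‖μ‖)) := by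
  obtain ⟨hc0, hc1⟩ := hc
  have hS1 : 0 < S + 1 := by linarith
  set b := (1 + c) / 2 with hb
  have hb1 : b ∈ Ioo (0 : ℝ) 1 := ⟨by linarith, by linarith⟩
  obtain ⟨D, hD, hDle⟩ :=
    exists_integral_exp_neg_mul_add_div_mul_rpow_le S (a := b - c) (by linarith)
  have hA : 0 < (2 / (1 - c)) ^ (1 + S) :=
    rpow_pos_of_pos (div_pos two_pos (by linarith)) _
  have hB : 0 < (2 / (1 - b)) ^ (1 + S) :=
    rpow_pos_of_pos (div_pos two_pos (by linarith [hb1.2])) _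
  set A := (2 / (1 - c)) ^ (1 + S)
  set B := (2 / (1 - b)) ^ (1 + S)
  refine ⟨2 * A + B * D, by positivity, fun l hl μ _ => ?_⟩
  have hL : 0 < l + (S + 1) * ‖μ‖ := by positivity
  have hIc := abs_integral_Sfun_Tfun_le hS ⟨hc0, hc1⟩ hl (norm_nonneg μ)
  have hIb := abs_integral_Sfun_Tfun_le hS hb1 hl (norm_nonneg μ)
  set L := l + (S + 1) * ‖μ‖
  refine ⟨hIc.trans ?_, hIb.trans ?_⟩
  · rw [mul_assoc, rpow_half_mul_besselK hc0 hL]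
    have hJ : 0 ≤ ∫ t in Ioi (0 : ℝ), exp (-(c * L * t + c / t)) * t ^ (-S - 1) :=
      setIntegral_nonneg measurableSet_Ioi fun t ht =>
        mul_nonneg (exp_pos _).le (rpow_nonneg (mem_Ioi.1 ht).le _)
    have := mul_nonneg (mul_pos hB hD).le hJ
    linarith
  · have hG : 0 ≤ if S = 0 then log (exp 1 + 1 / L) else L ^ (min S 0) := by
      split_ifs
      · have : 0 < 1 / L := by positivity
        exact log_nonneg (by linarith [one_le_exp (zero_le_one' ℝ)])
      · positivity
    set G := if S = 0 then log (exp 1 + 1 / L) else L ^ (min S 0)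
    calc _ ≤ B * (exp (-2 * c * √L) * (D * G)) := by
          gcongr
          refine (integral_exp_neg_mul_add_div_mul_rpow_le hc0 (by linarith) hL rfl _).trans ?_
          gcongr
          exact hDle L hL
      _ = B * D * G * exp (-2 * c * √L) := by ring
      _ ≤ _ := by
          gcongr
          linarith
end
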